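/- Let p ≥ 5 be a prime. For each x with 0 ≤ x < p, let M_x be the Lie ring ⟨a, b | [b,a,b] − [b,a,a,a], [b,a,a,a,b] − x•[b,a,a,a,a,a], p•a, p•b, class 6⟩, i.e., the quotient of the free Lie ring on generators a, b by the Lie ideal generated by the listed elements together with the 7th term of the lower central series. Then the number of isomorphism classes of Lie rings L of cardinality p^8, nilpotent of class exactly 7, such that L/L⁷ ≅ M_x for some x ∈ {0, 1, …, p−1}, equals 2p³ + 3p² + p + 3p·gcd(p−1,3) + (p+1)·gcd(p−1,7) + gcd(p−1,8). -/

import Mathlib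

/-- An isomorphism between two Lie rings (Lie algebras over `ℤ`) exists. -/
def IsLieIso (α β : Type*) [LieRing α] [LieRing β] : Prop :=
  ∃ e : α ≃ β, (∀ x y, e (x + y) = e x + e y) ∧ (∀ x y, e ⁅x, y⁆ = ⁅e x, e y⁆)

/-- A Lie ring is nilpotent of class exactly `c`: `L^{c+1} = 0` and `L^c ≠ 0`. -/
def LieClassEq (α : Type*) [LieRing α] (c : ℕ) : Prop :=
  LieModule.lowerCentralSeries ℤ α α c = ⊥ ∧ LieModule.lowerCentralSeries ℤ α α (c - 1) ≠ ⊥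

/-- The free Lie ring on two generators. -/
abbrev FL : Type := FreeLieAlgebra ℤ (Fin 2)

/-- The generator `a`. -/
noncomputable def ga : FL := FreeLieAlgebra.of ℤ 0
/-- The generator `b`. -/
noncomputable def gb : FL := FreeLieAlgebra.of ℤ 1
/-- The left-normed bracket `[b,a,b]`. -/
noncomputable def bab : FL := ⁅⁅gb, ga⁆, gb⁆
/-- The left-normed bracket `[b,a,a,a]`. -/
noncomputable def ba3 : FL := ⁅⁅⁅gb, ga⁆, ga⁆, ga⁆
/-- The left-normed bracket `[b,a,a,a,b]`. -/
noncomputable def ba3b : FL := ⁅ba3, gb⁆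
/-- The left-normed bracket `[b,a,a,a,a]`. -/
noncomputable def ba4 : FL := ⁅ba3, ga⁆
/-- The left-normed bracket `[b,a,a,a,a,a]`. -/
noncomputable def ba5 : FL := ⁅ba4, ga⁆

/-- The quotient of the free Lie ring on `a, b` by the Lie ideal generated by the
given relator set together with `p•a`, `p•b` and the 7th term of the lower central
series (i.e. the presentation is of class at most 6). -/
abbrev presLie (p : ℕ) (rels : Set FL) : Type :=
  FL ⧸ (LieSubmodule.lieSpan ℤ FL (rels ∪ {p • ga, p • gb}) ⊔
    LieModule.lowerCentralSeries ℤ FL FL 6)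

/-- `s` is a Lie ring structure of maximal class 7 on a set of size `p^8` whose
quotient by the 7th term of the lower central series is isomorphic to `β`. -/
def IsMaxClassDescendantOf (p : ℕ) (β : Type*) [LieRing β]
    (s : LieRing (Fin (p ^ 8))) : Prop := by
  letI := s
  exact LieClassEq (Fin (p ^ 8)) 7 ∧
    IsLieIso (Fin (p ^ 8) ⧸ LieModule.lowerCentralSeries ℤ (Fin (p ^ 8)) (Fin (p ^ 8)) 6) β

set_option linter.unusedSectionVars false

namespace MaxClass

/-- Structure constants of a class 7 Lie ring covering a member of the family. -/
@[ext] structure Params (p : ℕ) where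
  x : ZMod p
  r : ZMod p
  q : ZMod p
  ν : ZMod p
  ω : ZMod p
  γ : ZMod p
  δ : ZMod p

/-- The left-normed bracket `[b, a, …, a]` with `k` entries `a`. -/
def chain {L : Type*} [LieRing L] (a b : L) : ℕ → L
  | 0 => b
  | k + 1 => ⁅chain a b k, a⁆

/-- The elements `a`, `b` of `L` satisfy the defining relations with structure constants `θ`,
where `ζ` parametrizes the last term of the lower central series. -/
structure Realizes {p : ℕ} {L : Type*} [LieRing L] (θ : Params p) (a b : L)
    (ζ : ZMod p →+ L) : Prop where
  ζa : ∀ t, ⁅ζ t, a⁆ = 0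
  ζb : ∀ t, ⁅ζ t, b⁆ = 0
  v5a : ⁅chain a b 5, a⁆ = ζ θ.ν
  v5b : ⁅chain a b 5, b⁆ = ζ θ.ω
  v1b : ⁅chain a b 1, b⁆ = chain a b 3 + ζ θ.r
  v3b : ⁅chain a b 3, b⁆ = θ.x.val • chain a b 5 + ζ θ.q
  pa : p • a = ζ θ.γ
  pb : p • b = ζ θ.δ

section
variable {L : Type*} [LieRing L]

lemma chain_succ (a b : L) (k : ℕ) : ⁅chain a b k, a⁆ = chain a b (k + 1) := rfl

lemma chain_one (a b : L) : ⁅b, a⁆ = chain a b 1 := rfl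

lemma map_chain {L' : Type*} [LieRing L'] (φ : L →ₗ⁅ℤ⁆ L') (a b : L) (k : ℕ) :
    φ (chain a b k) = chain (φ a) (φ b) k := by
  induction k with
  | zero => rfl
  | succ k ih => simp only [chain, LieHom.map_lie, ih]

lemma lie_right_comm (a b y : L) : ⁅⁅y, a⁆, b⁆ = ⁅⁅y, b⁆, a⁆ - ⁅y, ⁅b, a⁆⁆ := by
  rw [lie_lie y a b, ← lie_skew a ⁅y, b⁆, ← lie_skew a b, lie_neg]
  abel

lemma lie_lie_eq (a b y : L) : ⁅y, ⁅b, a⁆⁆ = ⁅⁅y, b⁆, a⁆ - ⁅⁅y, a⁆, b⁆ := by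
  rw [lie_right_comm a b y]; abel

variable {p : ℕ} [Fact p.Prime]

lemma val_nsmul_map (ζ : ZMod p →+ L) (x t : ZMod p) : x.val • ζ t = ζ (x * t) := by
  rw [← map_nsmul, nsmul_eq_mul, ZMod.natCast_zmod_val]

namespace Realizes
variable {θ : Params p} {a b : L} {ζ : ZMod p →+ L}

lemma p_chain (h : Realizes θ a b ζ) (k : ℕ) : p • chain a b (k + 1) = 0 := by
  induction k with
  | zero => simp only [chain, ← nsmul_lie, h.pb, h.ζa]
  | succ k ih => rw [chain, ← nsmul_lie, ih, zero_lie]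

lemma v2b (h : Realizes θ a b ζ) : ⁅chain a b 2, b⁆ = chain a b 4 := by
  rw [← chain_succ, lie_right_comm, h.v1b, chain_one a b, lie_self, add_lie, h.ζa, chain_succ]
  abel

lemma v2v1 (h : Realizes θ a b ζ) : ⁅chain a b 2, chain a b 1⁆ =
    chain a b 5 - θ.x.val • chain a b 5 - ζ θ.q := by
  rw [← chain_one, lie_lie_eq, h.v2b, chain_succ, chain_succ, h.v3b]
  abel

lemma v3v1 (h : Realizes θ a b ζ) : ⁅chain a b 3, chain a b 1⁆ = ζ ((1 - θ.x) * θ.ν) := by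
  rw [← chain_succ a b 2, lie_right_comm, h.v2v1, chain_succ, lie_self, sub_lie, sub_lie, h.ζa,
    nsmul_lie, h.v5a, val_nsmul_map, sub_mul, map_sub, one_mul]
  abel

lemma v4b (h : Realizes θ a b ζ) : ⁅chain a b 4, b⁆ = ζ ((2 * θ.x - 1) * θ.ν) := by
  rw [← chain_succ, lie_right_comm, h.v3b, chain_one a b, h.v3v1, add_lie, nsmul_lie, h.v5a, h.ζa,
    val_nsmul_map, add_zero, ← map_sub]
  ring_nf

lemma v4v1 (h : Realizes θ a b ζ) : ⁅chain a b 4, chain a b 1⁆ = ζ (-θ.ω) := by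
  rw [← chain_one, lie_lie_eq, h.v4b, chain_succ, h.v5b, h.ζa, map_neg, zero_sub]

lemma v3v2 (h : Realizes θ a b ζ) : ⁅chain a b 3, chain a b 2⁆ = ζ θ.ω := by
  have e := lie_right_comm a (chain a b 1) (chain a b 3)
  rw [h.v3v1, h.ζa, chain_succ, chain_succ, h.v4v1, map_neg] at e
  rw [zero_sub, neg_inj] at e
  exact e.symm

lemma lie_chain_map (h : Realizes θ a b ζ) (j : ℕ) (t : ZMod p) :
    ⁅chain a b j, ζ t⁆ = 0 := by
  rw [← lie_skew, neg_eq_zero]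
  induction j with
  | zero => exact h.ζb t
  | succ j ih => rw [chain, lie_lie_eq, ih, h.ζa]; simp

lemma jacobi (h : Realizes θ a b ζ) : ζ ((3 - θ.x) * θ.ω) = 0 := by
  have e := lie_lie_eq (chain a b 1) b (chain a b 2)
  have e2 : ⁅b, chain a b 1⁆ = -(chain a b 3 + ζ θ.r) := by rw [← h.v1b, lie_skew]
  have e4 : ⁅chain a b 2, chain a b 3⁆ = - ζ θ.ω := by rw [← h.v3v2, lie_skew]
  rw [e2, h.v2v1, h.v2b, h.v4v1, lie_neg, lie_add, h.lie_chain_map, e4, sub_lie, sub_lie, h.ζb, nsmul_lie, h.v5b,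
    val_nsmul_map] at e
  rw [sub_mul, map_sub, show (3 : ZMod p) * θ.ω = θ.ω + θ.ω + θ.ω by ring, map_add, map_add]
  rw [map_neg] at e
  have e5 := sub_eq_zero.mpr e
  rw [← e5]
  abel

lemma map {L' : Type*} [LieRing L'] (h : Realizes θ a b ζ) (φ : L →ₗ⁅ℤ⁆ L') :
    Realizes θ (φ a) (φ b) ((φ : L →+ L').comp ζ) where
  ζa t := by simpa using congrArg φ (h.ζa t)
  ζb t := by simpa using congrArg φ (h.ζb t)
  v5a := by simpa [map_chain] using congrArg φ h.v5a
  v5b := by simpa [map_chain] using congrArg φ h.v5b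
  v1b := by simpa [map_chain] using congrArg φ h.v1b
  v3b := by simpa [map_chain] using congrArg φ h.v3b
  pa := by simpa using congrArg φ h.pa
  pb := by simpa using congrArg φ h.pb

end Realizes

/-- Generators of an upper bound for the terms of the lower central series. -/
def layerGens (θ : Params p) (a b : L) (ζ : ZMod p →+ L) (k : ℕ) : Set L :=
  {y | (∃ j, k ≤ j ∧ j ≤ 5 ∧ y = chain a b j) ∨ (k = 0 ∧ y = a) ∨ (k ≤ 5 ∧ ∃ t, y = ζ t) ∨
    (k = 6 ∧ (y = ζ θ.ν ∨ y = ζ θ.ω))}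

/-- An upper bound for the terms of the lower central series. -/
def layer (θ : Params p) (a b : L) (ζ : ZMod p →+ L) (k : ℕ) : AddSubgroup L :=
  AddSubgroup.closure (layerGens θ a b ζ k)

section layer
variable {θ : Params p} {a b : L} {ζ : ZMod p →+ L}

lemma chain_mem_layer {k j : ℕ} (hk : k ≤ j) (hj : j ≤ 5) : chain a b j ∈ layer θ a b ζ k :=
  AddSubgroup.subset_closure (Or.inl ⟨j, hk, hj, rfl⟩)

lemma map_mem_layer {k : ℕ} (hk : k ≤ 5) (t : ZMod p) : ζ t ∈ layer θ a b ζ k :=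
  AddSubgroup.subset_closure (Or.inr (Or.inr (Or.inl ⟨hk, t, rfl⟩)))

lemma ν_mem_layer {k : ℕ} (hk : k ≤ 6) : ζ θ.ν ∈ layer θ a b ζ k := by
  rcases Nat.lt_or_ge k 6 with h | h
  · exact map_mem_layer (by omega) _
  · exact AddSubgroup.subset_closure (Or.inr (Or.inr (Or.inr ⟨by omega, Or.inl rfl⟩)))

lemma ω_mem_layer {k : ℕ} (hk : k ≤ 6) : ζ θ.ω ∈ layer θ a b ζ k := by
  rcases Nat.lt_or_ge k 6 with h | h
  · exact map_mem_layer (by omega) _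
  · exact AddSubgroup.subset_closure (Or.inr (Or.inr (Or.inr ⟨by omega, Or.inr rfl⟩)))

lemma layer_succ_le (k : ℕ) : layer θ a b ζ (k + 1) ≤ layer θ a b ζ k := by
  rw [layer, AddSubgroup.closure_le]
  rintro y (⟨j, h1, h2, rfl⟩ | ⟨h1, rfl⟩ | ⟨h1, t, rfl⟩ | ⟨h1, rfl | rfl⟩)
  · exact chain_mem_layer (by omega) h2
  · omega
  · exact map_mem_layer (by omega) t
  · exact ν_mem_layer (by omega)
  · exact ω_mem_layer (by omega)

lemma layer_seven : layer θ a b ζ 7 = ⊥ := by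
  rw [layer, AddSubgroup.closure_eq_bot_iff]
  rintro y (⟨j, h1, h2, rfl⟩ | ⟨h1, rfl⟩ | ⟨h1, t, rfl⟩ | ⟨h1, rfl | rfl⟩) <;> omega

lemma Realizes.lie_a_mem (h : Realizes θ a b ζ) (k : ℕ) (y : L) (hy : y ∈ layerGens θ a b ζ k) :
    ⁅y, a⁆ ∈ layer θ a b ζ (k + 1) := by
  rcases hy with ⟨j, h1, h2, rfl⟩ | ⟨h1, rfl⟩ | ⟨h1, t, rfl⟩ | ⟨h1, rfl | rfl⟩
  · rcases Nat.lt_or_ge j 5 with h5 | h5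
    · exact chain_mem_layer (j := j + 1) (by omega) (by omega)
    · obtain rfl : j = 5 := by omega
      rw [h.v5a]; exact ν_mem_layer (by omega)
  · rw [lie_self]; exact zero_mem _
  all_goals rw [h.ζa]; exact zero_mem _

lemma Realizes.lie_b_mem (h : Realizes θ a b ζ) (k : ℕ) (y : L) (hy : y ∈ layerGens θ a b ζ k) :
    ⁅y, b⁆ ∈ layer θ a b ζ (k + 1) := by
  rcases hy with ⟨j, h1, h2, rfl⟩ | ⟨h1, rfl⟩ | ⟨h1, t, rfl⟩ | ⟨h1, rfl | rfl⟩
  · interval_cases j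
    · rw [chain, lie_self]; exact zero_mem _
    · rw [h.v1b]
      exact add_mem (chain_mem_layer (by omega) (by omega)) (map_mem_layer (by omega) _)
    · rw [h.v2b]; exact chain_mem_layer (by omega) (by omega)
    · rw [h.v3b]
      exact add_mem (nsmul_mem (chain_mem_layer (by omega) (by omega)) _)
        (map_mem_layer (by omega) _)
    · rw [h.v4b]; exact map_mem_layer (by omega) _
    · rw [h.v5b]; exact ω_mem_layer (by omega)
  · rw [← lie_skew, chain_one, h1]; exact neg_mem (chain_mem_layer (by omega) (by omega))
  all_goals rw [h.ζb]; exact zero_mem _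

lemma Realizes.lie_map_mem (h : Realizes θ a b ζ) (k : ℕ) (y : L) (hy : y ∈ layerGens θ a b ζ k)
    (t : ZMod p) : ⁅y, ζ t⁆ ∈ layer θ a b ζ (k + 1) := by
  have ha : ⁅a, ζ t⁆ = 0 := by rw [← lie_skew, h.ζa, neg_zero]
  have hν : ∀ s, ⁅ζ s, ζ t⁆ ∈ layer θ a b ζ (k + 1) := fun s => by
    rcases eq_or_ne t 0 with rfl | ht
    · simp
    have : ⁅ζ s, ζ t⁆ = 0 := by
      have e : s = t * (t⁻¹ * s) := by field_simp
      have e2 : ζ s = (t⁻¹ * s).val • ζ t := by rw [val_nsmul_map, mul_comm, ← e]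
      rw [e2, nsmul_lie, lie_self, smul_zero]
    rw [this]; exact zero_mem _
  rcases hy with ⟨j, h1, h2, rfl⟩ | ⟨h1, rfl⟩ | ⟨h1, t, rfl⟩ | ⟨h1, rfl | rfl⟩
  · rw [h.lie_chain_map]; exact zero_mem _
  · rw [ha]; exact zero_mem _
  all_goals exact hν _

lemma lie_mem_of_gens {x : L} {k : ℕ}
    (hx : ∀ y ∈ layerGens θ a b ζ k, ⁅y, x⁆ ∈ layer θ a b ζ (k + 1)) :
    ∀ y ∈ layer θ a b ζ k, ⁅y, x⁆ ∈ layer θ a b ζ (k + 1) := by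
  intro y hy
  induction hy using AddSubgroup.closure_induction with
  | mem y hy => exact hx y hy
  | zero => simp
  | add y z _ _ h1 h2 => rw [add_lie]; exact add_mem h1 h2
  | neg y _ h1 => rw [neg_lie]; exact neg_mem h1

lemma Realizes.lie_mem_layer (h : Realizes θ a b ζ) {x : L}
    (hx : x ∈ LieSubalgebra.lieSpan ℤ L ({a, b} ∪ Set.range ζ)) :
    ∀ k, ∀ y ∈ layer θ a b ζ k, ⁅y, x⁆ ∈ layer θ a b ζ (k + 1) := by
  induction hx using LieSubalgebra.lieSpan_induction with
  | mem x hx =>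
    intro k
    apply lie_mem_of_gens
    intro y hy
    rcases hx with (rfl | rfl) | ⟨t, rfl⟩
    · exact h.lie_a_mem k y hy
    · exact h.lie_b_mem k y hy
    · exact h.lie_map_mem k y hy t
  | zero => intro k y _; simp
  | add x x' _ _ h1 h2 => intro k y hy; rw [lie_add]; exact add_mem (h1 k y hy) (h2 k y hy)
  | smul n x _ h1 => intro k y hy; rw [lie_smul]; exact zsmul_mem (h1 k y hy) _
  | lie x x' _ _ h1 h2 =>
    intro k y hy
    rw [lie_lie_eq]
    exact sub_mem (layer_succ_le _ (h2 _ _ (h1 k y hy))) (layer_succ_le _ (h1 _ _ (h2 k y hy)))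

lemma Realizes.lieSpan_le_layer (h : Realizes θ a b ζ) {x : L}
    (hx : x ∈ LieSubalgebra.lieSpan ℤ L ({a, b} ∪ Set.range ζ)) : x ∈ layer θ a b ζ 0 := by
  induction hx using LieSubalgebra.lieSpan_induction with
  | mem x hx =>
    rcases hx with (rfl | rfl) | ⟨t, rfl⟩
    · exact AddSubgroup.subset_closure (Or.inr (Or.inl ⟨rfl, rfl⟩))
    · exact chain_mem_layer (j := 0) le_rfl (by omega)
    · exact map_mem_layer (by omega) t
  | zero => exact zero_mem _
  | add x x' _ _ h1 h2 => exact add_mem h1 h2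
  | smul n x _ h1 => exact zsmul_mem h1 _
  | lie x x' _ h2 h1 _ => exact layer_succ_le _ (h.lie_mem_layer h2 0 x h1)

lemma Realizes.lowerCentralSeries_le (h : Realizes θ a b ζ)
    (hL : LieSubalgebra.lieSpan ℤ L ({a, b} ∪ Set.range ζ) = ⊤) (k : ℕ) :
    ∀ y ∈ LieModule.lowerCentralSeries ℤ L L k, y ∈ layer θ a b ζ k := by
  induction k with
  | zero => intro y _; exact h.lieSpan_le_layer (hL ▸ LieSubalgebra.mem_top y)
  | succ k ih =>
    intro y hy
    rw [LieModule.lowerCentralSeries_succ, ← LieSubmodule.mem_toSubmodule,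
      LieSubmodule.lieIdeal_oper_eq_linear_span'] at hy
    induction hy using Submodule.span_induction with
    | mem y hy =>
      obtain ⟨x, -, n, hn, rfl⟩ := hy
      rw [← lie_skew]
      exact neg_mem (h.lie_mem_layer (hL ▸ LieSubalgebra.mem_top x) k n (ih n hn))
    | zero => exact zero_mem _
    | add y z _ _ h1 h2 => exact add_mem h1 h2
    | smul n y _ h1 => exact zsmul_mem h1 n

lemma chain_mem_lowerCentralSeries (a b : L) (k : ℕ) :
    chain a b k ∈ LieModule.lowerCentralSeries ℤ L L k := by
  induction k with
  | zero => simp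
  | succ k ih =>
    rw [LieModule.lowerCentralSeries_succ, chain, ← lie_skew]
    exact neg_mem (LieSubmodule.lie_mem_lie (LieSubmodule.mem_top a) ih)

lemma lie_mem_lowerCentralSeries {k : ℕ} {y : L} (x : L)
    (hy : y ∈ LieModule.lowerCentralSeries ℤ L L k) :
    ⁅y, x⁆ ∈ LieModule.lowerCentralSeries ℤ L L (k + 1) := by
  rw [LieModule.lowerCentralSeries_succ, ← lie_skew]
  exact neg_mem (LieSubmodule.lie_mem_lie (LieSubmodule.mem_top x) hy)

end layer
end
end MaxClass

namespace MaxClass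

section card
variable {G : Type*} [AddCommGroup G]

lemma card_sup_zmultiples_le {p : ℕ} (hp : 0 < p) (K : AddSubgroup G) [Finite K] (e : G)
    (he : p • e ∈ K) : Finite ↥(K ⊔ AddSubgroup.zmultiples e) ∧
      Nat.card ↥(K ⊔ AddSubgroup.zmultiples e) ≤ p * Nat.card K := by
  let f : Fin p × K → ↥(K ⊔ AddSubgroup.zmultiples e) := fun x =>
    ⟨x.2 + (x.1 : ℕ) • e, add_mem (AddSubgroup.mem_sup_left x.2.2)
      (AddSubgroup.mem_sup_right (nsmul_mem (AddSubgroup.mem_zmultiples e) _))⟩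
  have hf : Function.Surjective f := by
    rintro ⟨y, hy⟩
    obtain ⟨k, hk, m, hm, rfl⟩ := AddSubgroup.mem_sup.mp hy
    obtain ⟨n, rfl⟩ := AddSubgroup.mem_zmultiples_iff.mp hm
    have hp' : (0 : ℤ) < p := by exact_mod_cast hp
    have h1 := Int.emod_nonneg n hp'.ne'
    have h2 := Int.emod_lt_of_pos n hp'
    refine ⟨⟨⟨(n % p).toNat, by omega⟩, ⟨k + (n / p) • (p • e), add_mem hk (zsmul_mem he _)⟩⟩, ?_⟩
    apply Subtype.ext
    simp only [f]
    rw [← natCast_zsmul e (n % p).toNat, Int.toNat_of_nonneg h1, add_assoc, ← natCast_zsmul e p,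
      smul_smul, ← add_smul, mul_comm, Int.mul_ediv_add_emod]
  refine ⟨Finite.of_surjective f hf, ?_⟩
  have := Nat.card_le_card_of_surjective f hf
  rwa [Nat.card_prod, Nat.card_fin] at this

end card

section
variable {L : Type*} [LieRing L] {p : ℕ} [Fact p.Prime] {θ : Params p} {a b : L} {ζ : ZMod p →+ L}

lemma Realizes.card_layer_le (h : Realizes θ a b ζ) :
    Finite ↥(layer θ a b ζ 0) ∧ Nat.card ↥(layer θ a b ζ 0) ≤ p ^ 7 * Nat.card ζ.range := by
  have hp : 0 < p := (Fact.out : p.Prime).pos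
  have : Finite ζ.range := Set.finite_range ζ
  have hr : ∀ t, ζ t ∈ ζ.range := fun t => ⟨t, rfl⟩
  obtain ⟨i1, c1⟩ := card_sup_zmultiples_le hp ζ.range a (h.pa ▸ hr _)
  obtain ⟨i2, c2⟩ := card_sup_zmultiples_le hp _ (chain a b 0)
    (AddSubgroup.mem_sup_left (h.pb ▸ hr _ : p • chain a b 0 ∈ ζ.range) :
      _ ∈ ζ.range ⊔ AddSubgroup.zmultiples a)
  obtain ⟨i3, c3⟩ := card_sup_zmultiples_le hp _ (chain a b 1)
    (by rw [h.p_chain]; exact zero_mem (ζ.range ⊔ AddSubgroup.zmultiples a ⊔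
      AddSubgroup.zmultiples (chain a b 0)))
  obtain ⟨i4, c4⟩ := card_sup_zmultiples_le hp _ (chain a b 2)
    (by rw [h.p_chain]; exact zero_mem (ζ.range ⊔ AddSubgroup.zmultiples a ⊔
      AddSubgroup.zmultiples (chain a b 0) ⊔ AddSubgroup.zmultiples (chain a b 1)))
  obtain ⟨i5, c5⟩ := card_sup_zmultiples_le hp _ (chain a b 3)
    (by rw [h.p_chain]; exact zero_mem (ζ.range ⊔ AddSubgroup.zmultiples a ⊔
      AddSubgroup.zmultiples (chain a b 0) ⊔ AddSubgroup.zmultiples (chain a b 1) ⊔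
      AddSubgroup.zmultiples (chain a b 2)))
  obtain ⟨i6, c6⟩ := card_sup_zmultiples_le hp _ (chain a b 4)
    (by rw [h.p_chain]; exact zero_mem (ζ.range ⊔ AddSubgroup.zmultiples a ⊔
      AddSubgroup.zmultiples (chain a b 0) ⊔ AddSubgroup.zmultiples (chain a b 1) ⊔
      AddSubgroup.zmultiples (chain a b 2) ⊔ AddSubgroup.zmultiples (chain a b 3)))
  obtain ⟨i7, c7⟩ := card_sup_zmultiples_le hp _ (chain a b 5)
    (by rw [h.p_chain]; exact zero_mem (ζ.range ⊔ AddSubgroup.zmultiples a ⊔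
      AddSubgroup.zmultiples (chain a b 0) ⊔ AddSubgroup.zmultiples (chain a b 1) ⊔
      AddSubgroup.zmultiples (chain a b 2) ⊔ AddSubgroup.zmultiples (chain a b 3) ⊔
      AddSubgroup.zmultiples (chain a b 4)))
  have hle : layer θ a b ζ 0 ≤ ζ.range ⊔ AddSubgroup.zmultiples a ⊔
      AddSubgroup.zmultiples (chain a b 0) ⊔ AddSubgroup.zmultiples (chain a b 1) ⊔
      AddSubgroup.zmultiples (chain a b 2) ⊔ AddSubgroup.zmultiples (chain a b 3) ⊔
      AddSubgroup.zmultiples (chain a b 4) ⊔ AddSubgroup.zmultiples (chain a b 5) := by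
    have hm : ∀ e : L, e ∈ AddSubgroup.zmultiples e := AddSubgroup.mem_zmultiples
    rw [layer, AddSubgroup.closure_le]
    rintro y (⟨j, h1, h2, rfl⟩ | ⟨h1, rfl⟩ | ⟨h1, t, rfl⟩ | ⟨h1, rfl | rfl⟩)
    · interval_cases j
      · exact AddSubgroup.mem_sup_left (AddSubgroup.mem_sup_left (AddSubgroup.mem_sup_left
          (AddSubgroup.mem_sup_left (AddSubgroup.mem_sup_left (AddSubgroup.mem_sup_right (hm _))))))
      · exact AddSubgroup.mem_sup_left (AddSubgroup.mem_sup_left (AddSubgroup.mem_sup_left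
          (AddSubgroup.mem_sup_left (AddSubgroup.mem_sup_right (hm _)))))
      · exact AddSubgroup.mem_sup_left (AddSubgroup.mem_sup_left (AddSubgroup.mem_sup_left
          (AddSubgroup.mem_sup_right (hm _))))
      · exact AddSubgroup.mem_sup_left (AddSubgroup.mem_sup_left
          (AddSubgroup.mem_sup_right (hm _)))
      · exact AddSubgroup.mem_sup_left (AddSubgroup.mem_sup_right (hm _))
      · exact AddSubgroup.mem_sup_right (hm _)
    · exact AddSubgroup.mem_sup_left (AddSubgroup.mem_sup_left (AddSubgroup.mem_sup_left
        (AddSubgroup.mem_sup_left (AddSubgroup.mem_sup_left (AddSubgroup.mem_sup_left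
          (AddSubgroup.mem_sup_right (hm _)))))))
    · exact AddSubgroup.mem_sup_left (AddSubgroup.mem_sup_left (AddSubgroup.mem_sup_left
        (AddSubgroup.mem_sup_left (AddSubgroup.mem_sup_left (AddSubgroup.mem_sup_left
          (AddSubgroup.mem_sup_left (hr _)))))))
    all_goals omega
  refine ⟨Finite.of_injective _ (AddSubgroup.inclusion_injective hle),
    (Nat.card_le_card_of_injective _ (AddSubgroup.inclusion_injective hle)).trans ?_⟩
  calc _ ≤ _ := c7
    _ ≤ p * (p * (p * (p * (p * (p * (p * Nat.card ζ.range)))))) := by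
      gcongr
      exact c6.trans (by gcongr; exact c5.trans (by gcongr; exact c4.trans (by
        gcongr; exact c3.trans (by gcongr; exact c2.trans (by gcongr)))))
    _ = p ^ 7 * Nat.card ζ.range := by ring

end

section ZModSq
variable {p : ℕ} [hp : Fact p.Prime]

/-- Multiplication by `p`, as an embedding of `ℤ/p` into `ℤ/p²`. -/
def pMul (p : ℕ) : ZMod p →+ ZMod (p ^ 2) :=
  ZMod.lift p ⟨(AddMonoidHom.mulLeft (p : ZMod (p ^ 2))).comp (Int.castAddHom _), by
    have : ((p ^ 2 : ℕ) : ZMod (p ^ 2)) = 0 := ZMod.natCast_self _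
    push_cast at this
    simpa [← pow_two] using this⟩

/-- Reduction modulo `p`. -/
def red (p : ℕ) : ZMod (p ^ 2) →+* ZMod p := ZMod.castHom (dvd_pow_self p two_ne_zero) (ZMod p)

lemma pMul_intCast (n : ℤ) : pMul p (n : ZMod p) = p * n := by
  simp [pMul]

lemma red_pMul (t : ZMod p) : red p (pMul p t) = 0 := by
  obtain ⟨n, rfl⟩ := ZMod.intCast_surjective t
  rw [pMul_intCast, map_mul, map_natCast, ZMod.natCast_self, zero_mul]

lemma pMul_red (u : ZMod (p ^ 2)) : pMul p (red p u) = p • u := by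
  obtain ⟨n, rfl⟩ := ZMod.intCast_surjective u
  rw [map_intCast, pMul_intCast, nsmul_eq_mul]

lemma pMul_injective : Function.Injective (pMul p) := by
  rw [injective_iff_map_eq_zero]
  intro t ht
  obtain ⟨n, rfl⟩ := ZMod.intCast_surjective t
  have hp0 : (p : ℤ) ≠ 0 := by exact_mod_cast hp.out.ne_zero
  rw [pMul_intCast, ← Int.cast_natCast, ← Int.cast_mul, ZMod.intCast_zmod_eq_zero_iff_dvd] at ht
  rw [ZMod.intCast_zmod_eq_zero_iff_dvd]
  push_cast at ht
  rw [pow_two] at ht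
  exact Int.dvd_of_mul_dvd_mul_left hp0 ht

lemma exists_pMul_eq {u : ZMod (p ^ 2)} (hu : red p u = 0) : ∃ t, u = pMul p t := by
  obtain ⟨n, rfl⟩ := ZMod.intCast_surjective u
  rw [map_intCast, ZMod.intCast_zmod_eq_zero_iff_dvd] at hu
  obtain ⟨m, rfl⟩ := hu
  exact ⟨(m : ZMod p), by rw [pMul_intCast]; push_cast; ring⟩

lemma red_surjective : Function.Surjective (red p) := fun t => by
  obtain ⟨n, rfl⟩ := ZMod.intCast_surjective t
  exact ⟨n, map_intCast _ _⟩

end ZModSq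

/-- The homomorphism whose kernel is the additive group of the model with structure constants
`θ`. -/
def modelHom {p : ℕ} (θ : Params p) : (Fin 7 → ZMod p) × ZMod (p ^ 2) →+ ZMod p where
  toFun w := red p w.2 - (θ.γ * w.1 0 + θ.δ * w.1 1)
  map_zero' := by simp
  map_add' v w := by simp only [Prod.snd_add, Prod.fst_add, Pi.add_apply, map_add]; ring

/-- The Lie ring of order `p ^ 8` with structure constants `θ`. The coordinates are those of
`a, b, [b,a], …, [b,a,a,a,a,a]`, followed by an element of `ℤ/p²` in which the last term of the
lower central series is `p ℤ/p²`. -/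
def Model {p : ℕ} (θ : Params p) : Type := ↥(modelHom θ).ker

namespace Model
variable {p : ℕ} {θ : Params p}

instance : AddCommGroup (Model θ) := inferInstanceAs (AddCommGroup ↥(modelHom θ).ker)

/-- The coordinates of an element of the model. -/
def co (X : Model θ) : Fin 7 → ZMod p := X.1.1

/-- The coordinate of an element of the model in `ℤ/p²`. -/
def top (X : Model θ) : ZMod (p ^ 2) := X.1.2

@[simp] lemma co_add (X Y : Model θ) (i) : (X + Y).co i = X.co i + Y.co i := rfl
@[simp] lemma co_neg (X : Model θ) (i) : (-X).co i = -X.co i := rfl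
@[simp] lemma co_sub (X Y : Model θ) (i) : (X - Y).co i = X.co i - Y.co i := rfl
@[simp] lemma co_zero (i) : (0 : Model θ).co i = 0 := rfl
@[simp] lemma top_add (X Y : Model θ) : (X + Y).top = X.top + Y.top := rfl
@[simp] lemma top_zero : (0 : Model θ).top = 0 := rfl

@[simp] lemma co_nsmul (n : ℕ) (X : Model θ) (i) : (n • X).co i = n * X.co i := by
  rw [← nsmul_eq_mul]; rfl

@[simp] lemma top_nsmul (n : ℕ) (X : Model θ) : (n • X).top = n • X.top := rfl

lemma red_top (X : Model θ) : red p X.top = θ.γ * X.co 0 + θ.δ * X.co 1 :=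
  sub_eq_zero.mp X.2

lemma ext {X Y : Model θ} (h : ∀ i, X.co i = Y.co i) (ht : X.top = Y.top) : X = Y :=
  Subtype.ext (Prod.ext (funext h) ht)

variable [Fact p.Prime]

/-- An element of the derived subring given by coordinates. -/
def em (θ : Params p) (c d e f g z : ZMod p) : Model θ :=
  ⟨(![0, 0, c, d, e, f, g], pMul p z), by
    change red p (pMul p z) - (θ.γ * 0 + θ.δ * 0) = 0
    rw [red_pMul]; ring⟩

section em
variable (c d e f g z : ZMod p)
@[simp] lemma co_em_zero : (em θ c d e f g z).co 0 = 0 := rfl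
@[simp] lemma co_em_one : (em θ c d e f g z).co 1 = 0 := rfl
@[simp] lemma co_em_two : (em θ c d e f g z).co 2 = c := rfl
@[simp] lemma co_em_three : (em θ c d e f g z).co 3 = d := rfl
@[simp] lemma co_em_four : (em θ c d e f g z).co 4 = e := rfl
@[simp] lemma co_em_five : (em θ c d e f g z).co 5 = f := rfl
@[simp] lemma co_em_six : (em θ c d e f g z).co 6 = g := rfl
@[simp] lemma top_em : (em θ c d e f g z).top = pMul p z := rfl
end em

lemma ext' {X Y : Model θ} (h0 : X.co 0 = Y.co 0) (h1 : X.co 1 = Y.co 1) (h2 : X.co 2 = Y.co 2)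
    (h3 : X.co 3 = Y.co 3) (h4 : X.co 4 = Y.co 4) (h5 : X.co 5 = Y.co 5) (h6 : X.co 6 = Y.co 6)
    (ht : X.top = Y.top) : X = Y :=
  ext (fun i => by fin_cases i <;> assumption) ht

lemma em_add (c d e f g z c' d' e' f' g' z' : ZMod p) :
    em θ c d e f g z + em θ c' d' e' f' g' z' =
      em θ (c + c') (d + d') (e + e') (f + f') (g + g') (z + z') := by
  apply ext' <;> simp

lemma em_nsmul (n : ℕ) (c d e f g z : ZMod p) :
    n • em θ c d e f g z = em θ (n * c) (n * d) (n * e) (n * f) (n * g) (n * z) := by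
  apply ext' <;> simp only [co_nsmul, co_em_zero, co_em_one, co_em_two, co_em_three, co_em_four,
    co_em_five, co_em_six, mul_zero, top_nsmul, top_em]
  rw [← nsmul_eq_mul, map_nsmul]

lemma em_zero : em θ 0 0 0 0 0 0 = 0 := by
  apply ext' <;> simp

lemma em_inj {c d e f g z c' d' e' f' g' z' : ZMod p} :
    em θ c d e f g z = em θ c' d' e' f' g' z' ↔
      c = c' ∧ d = d' ∧ e = e' ∧ f = f' ∧ g = g' ∧ z = z' := by
  constructor
  · intro h
    exact ⟨congrArg (co · 2) h, congrArg (co · 3) h, congrArg (co · 4) h, congrArg (co · 5) h,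
      congrArg (co · 6) h, pMul_injective (congrArg top h)⟩
  · rintro ⟨rfl, rfl, rfl, rfl, rfl, rfl⟩; rfl

lemma eq_em {X : Model θ} (h0 : X.co 0 = 0) (h1 : X.co 1 = 0) :
    ∃ z, X = em θ (X.co 2) (X.co 3) (X.co 4) (X.co 5) (X.co 6) z := by
  obtain ⟨z, hz⟩ := exists_pMul_eq (u := X.top) (by rw [X.red_top, h0, h1]; ring)
  exact ⟨z, ext' (by simpa) (by simpa) rfl rfl rfl rfl rfl (by simpa)⟩

/-- The bracket of the model. -/
def lie (X Y : Model θ) : Model θ :=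
  let w := fun i j => X.co i * Y.co j - X.co j * Y.co i
  em θ (w 1 0) (w 2 0) (w 3 0 + w 2 1) (w 4 0 + w 3 1)
    (w 5 0 + θ.x * w 4 1 + (1 - θ.x) * w 3 2)
    (θ.ν * w 6 0 + θ.ω * w 6 1 + θ.r * w 2 1 + θ.q * w 4 1 + (2 * θ.x - 1) * θ.ν * w 5 1 -
      θ.q * w 3 2 + (1 - θ.x) * θ.ν * w 4 2 - θ.ω * w 5 2 + θ.ω * w 4 3)

variable [hj : Fact ((3 - θ.x) * θ.ω = 0)]

instance : LieRing (Model θ) where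
  bracket := lie
  add_lie X Y Z := by
    simp only [lie, em_add, co_add]
    congr 1 <;> ring
  lie_add X Y Z := by
    simp only [lie, em_add, co_add]
    congr 1 <;> ring
  lie_self X := by
    rw [← em_zero]
    simp only [lie]
    congr 1 <;> ring
  leibniz_lie X Y Z := by
    change lie X (lie Y Z) = lie (lie X Y) Z + lie Y (lie X Z)
    have h := hj.out
    simp only [lie, em_add, co_em_zero, co_em_one, co_em_two, co_em_three, co_em_four,
      co_em_five, co_em_six]
    congr 1
    · ring
    · ring
    · ring
    · ring
    · ring
    · linear_combination -(X.co 3 * (Y.co 2 * Z.co 1 - Y.co 1 * Z.co 2) -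
        X.co 2 * (Y.co 3 * Z.co 1 - Y.co 1 * Z.co 3) +
        X.co 1 * (Y.co 3 * Z.co 2 - Y.co 2 * Z.co 3)) * h

lemma lie_def (X Y : Model θ) : ⁅X, Y⁆ = lie X Y := rfl

end Model
end MaxClass

namespace MaxClass
namespace Model
variable {p : ℕ} [hp : Fact p.Prime] {θ : Params p}

/-- An element of the model with given coordinates. -/
noncomputable def ofCo (θ : Params p) (c : Fin 7 → ZMod p) : Model θ :=
  ⟨(c, Function.surjInv red_surjective (θ.γ * c 0 + θ.δ * c 1)), by
    change red p (Function.surjInv red_surjective _) - (θ.γ * c 0 + θ.δ * c 1) = 0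
    rw [Function.surjInv_eq red_surjective, sub_self]⟩

@[simp] lemma co_ofCo (c : Fin 7 → ZMod p) (i) : (ofCo θ c).co i = c i := rfl

/-- The last term of the lower central series of the model. -/
def zel (θ : Params p) : ZMod p →+ Model θ where
  toFun t := em θ 0 0 0 0 0 t
  map_zero' := em_zero
  map_add' s t := by rw [em_add]; simp

lemma zel_apply (t : ZMod p) : zel θ t = em θ 0 0 0 0 0 t := rfl

lemma zel_injective : Function.Injective (zel θ) := fun s t h => by
  simpa [zel_apply, em_inj] using h

lemma p_nsmul (X : Model θ) : p • X = zel θ (θ.γ * X.co 0 + θ.δ * X.co 1) := by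
  rw [zel_apply]
  apply ext' <;> simp only [co_nsmul, co_em_zero, co_em_one, co_em_two, co_em_three, co_em_four,
    co_em_five, co_em_six, top_nsmul, top_em, CharP.cast_eq_zero, zero_mul]
  rw [← red_top, pMul_red]

lemma card_eq : Nat.card (Model θ) = p ^ 8 := by
  have h1 : Function.Surjective (modelHom θ) := fun t => by
    obtain ⟨u, hu⟩ := red_surjective t
    exact ⟨(0, u), by simp [modelHom, hu]⟩
  have h2 := AddSubgroup.card_mul_index (modelHom θ).ker
  rw [AddSubgroup.index_ker, AddMonoidHom.range_eq_top.mpr h1, Nat.card_prod, Nat.card_fun,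
    Nat.card_zmod, Nat.card_zmod, Nat.card_fin, AddSubgroup.card_top, Nat.card_zmod] at h2
  have h3 : Nat.card (Model θ) * p = p ^ 8 * p := by
    rw [Model, h2]; ring
  exact Nat.eq_of_mul_eq_mul_right hp.out.pos h3

instance : Finite (Model θ) :=
  Nat.finite_of_card_ne_zero (by rw [card_eq]; exact pow_ne_zero _ hp.out.ne_zero)

/-- The first generator of the model. -/
noncomputable def a (θ : Params p) : Model θ := ofCo θ ![1, 0, 0, 0, 0, 0, 0]

/-- The second generator of the model. -/
noncomputable def b (θ : Params p) : Model θ := ofCo θ ![0, 1, 0, 0, 0, 0, 0]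

section gens
@[simp] lemma co_a_zero : (a θ).co 0 = 1 := rfl
@[simp] lemma co_a_one : (a θ).co 1 = 0 := rfl
@[simp] lemma co_a_two : (a θ).co 2 = 0 := rfl
@[simp] lemma co_a_three : (a θ).co 3 = 0 := rfl
@[simp] lemma co_a_four : (a θ).co 4 = 0 := rfl
@[simp] lemma co_a_five : (a θ).co 5 = 0 := rfl
@[simp] lemma co_a_six : (a θ).co 6 = 0 := rfl
@[simp] lemma co_b_zero : (b θ).co 0 = 0 := rfl
@[simp] lemma co_b_one : (b θ).co 1 = 1 := rfl
@[simp] lemma co_b_two : (b θ).co 2 = 0 := rfl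
@[simp] lemma co_b_three : (b θ).co 3 = 0 := rfl
@[simp] lemma co_b_four : (b θ).co 4 = 0 := rfl
@[simp] lemma co_b_five : (b θ).co 5 = 0 := rfl
@[simp] lemma co_b_six : (b θ).co 6 = 0 := rfl
end gens

variable [hj : Fact ((3 - θ.x) * θ.ω = 0)]

lemma zel_lie (t : ZMod p) (X : Model θ) : ⁅zel θ t, X⁆ = 0 := by
  rw [lie_def, lie, zel_apply, ← em_zero]
  simp

lemma lie_a (X : Model θ) :
    ⁅X, a θ⁆ = em θ (X.co 1) (X.co 2) (X.co 3) (X.co 4) (X.co 5) (θ.ν * X.co 6) := by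
  rw [lie_def, lie]
  simp

lemma lie_b (X : Model θ) :
    ⁅X, b θ⁆ = em θ (-X.co 0) 0 (X.co 2) (X.co 3) (θ.x * X.co 4)
      (θ.ω * X.co 6 + θ.r * X.co 2 + θ.q * X.co 4 + (2 * θ.x - 1) * θ.ν * X.co 5) := by
  rw [lie_def, lie]
  simp

lemma chain_ab_one : chain (a θ) (b θ) 1 = em θ 1 0 0 0 0 0 := by
  rw [chain, chain, lie_a]; simp

lemma chain_ab_two : chain (a θ) (b θ) 2 = em θ 0 1 0 0 0 0 := by
  rw [chain, chain_ab_one, lie_a]; simp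

lemma chain_ab_three : chain (a θ) (b θ) 3 = em θ 0 0 1 0 0 0 := by
  rw [chain, chain_ab_two, lie_a]; simp

lemma chain_ab_four : chain (a θ) (b θ) 4 = em θ 0 0 0 1 0 0 := by
  rw [chain, chain_ab_three, lie_a]; simp

lemma chain_ab_five : chain (a θ) (b θ) 5 = em θ 0 0 0 0 1 0 := by
  rw [chain, chain_ab_four, lie_a]; simp

lemma realizes : Realizes θ (a θ) (b θ) (zel θ) where
  ζa t := zel_lie t (a θ)
  ζb t := zel_lie t (b θ)
  v5a := by rw [chain_ab_five, lie_a]; simp [zel_apply]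
  v5b := by rw [chain_ab_five, lie_b]; simp [zel_apply]
  v1b := by rw [chain_ab_one, chain_ab_three, lie_b, zel_apply, em_add]; simp
  v3b := by rw [chain_ab_three, chain_ab_five, lie_b, zel_apply, em_nsmul, em_add]; simp
  pa := by rw [p_nsmul]; simp
  pb := by rw [p_nsmul]; simp

lemma exists_eq_sum (X : Model θ) : ∃ t, X = (X.co 0).val • a θ + (X.co 1).val • b θ +
    (X.co 2).val • chain (a θ) (b θ) 1 + (X.co 3).val • chain (a θ) (b θ) 2 +
    (X.co 4).val • chain (a θ) (b θ) 3 + (X.co 5).val • chain (a θ) (b θ) 4 +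
    (X.co 6).val • chain (a θ) (b θ) 5 + zel θ t := by
  set Y := (X.co 0).val • a θ + (X.co 1).val • b θ +
    (X.co 2).val • chain (a θ) (b θ) 1 + (X.co 3).val • chain (a θ) (b θ) 2 +
    (X.co 4).val • chain (a θ) (b θ) 3 + (X.co 5).val • chain (a θ) (b θ) 4 +
    (X.co 6).val • chain (a θ) (b θ) 5 with hY
  simp only [chain_ab_one, chain_ab_two, chain_ab_three, chain_ab_four, chain_ab_five] at hY
  have h0 : (X - Y).co 0 = 0 := by rw [hY]; simp
  have h1 : (X - Y).co 1 = 0 := by rw [hY]; simp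
  have h2 : (X - Y).co 2 = 0 := by rw [hY]; simp
  have h3 : (X - Y).co 3 = 0 := by rw [hY]; simp
  have h4 : (X - Y).co 4 = 0 := by rw [hY]; simp
  have h5 : (X - Y).co 5 = 0 := by rw [hY]; simp
  have h6 : (X - Y).co 6 = 0 := by rw [hY]; simp
  obtain ⟨z, hz⟩ := eq_em h0 h1
  rw [h2, h3, h4, h5, h6, ← zel_apply] at hz
  exact ⟨z, by rw [← hz]; abel⟩

lemma zel_mem (hθ : θ.ν ≠ 0 ∨ θ.ω ≠ 0) {H : LieSubalgebra ℤ (Model θ)} (ha : a θ ∈ H)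
    (hb : b θ ∈ H) (t : ZMod p) : zel θ t ∈ H := by
  have hc : ∀ k, chain (a θ) (b θ) k ∈ H := fun k => by
    induction k with
    | zero => exact hb
    | succ k ih => exact H.lie_mem ih ha
  have key : ∀ s, s ≠ 0 → zel θ s ∈ H → zel θ t ∈ H := fun s hs h => by
    have : zel θ t = (t / s).val • zel θ s := by
      rw [val_nsmul_map, div_mul_cancel₀ _ hs]
    rw [this]; exact nsmul_mem h _
  rcases hθ with h | h
  · exact key _ h ((realizes (θ := θ)).v5a ▸ H.lie_mem (hc 5) ha)
  · exact key _ h ((realizes (θ := θ)).v5b ▸ H.lie_mem (hc 5) hb)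

lemma lieSpan_eq_top (hθ : θ.ν ≠ 0 ∨ θ.ω ≠ 0) :
    LieSubalgebra.lieSpan ℤ (Model θ) {a θ, b θ} = ⊤ := by
  rw [eq_top_iff]
  intro X _
  set H := LieSubalgebra.lieSpan ℤ (Model θ) {a θ, b θ}
  have ha : a θ ∈ H := LieSubalgebra.subset_lieSpan (by simp)
  have hb : b θ ∈ H := LieSubalgebra.subset_lieSpan (by simp)
  have hc : ∀ k, chain (a θ) (b θ) k ∈ H := fun k => by
    induction k with
    | zero => exact hb
    | succ k ih => exact H.lie_mem ih ha
  obtain ⟨t, ht⟩ := exists_eq_sum X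
  rw [ht]
  have hn : ∀ (n : ℕ) (y), y ∈ H → n • y ∈ H := fun n y hy => nsmul_mem hy n
  exact add_mem (add_mem (add_mem (add_mem (add_mem (add_mem (add_mem (hn _ _ ha) (hn _ _ hb))
    (hn _ _ (hc _))) (hn _ _ (hc _))) (hn _ _ (hc _))) (hn _ _ (hc _))) (hn _ _ (hc _)))
    (zel_mem hθ ha hb t)

/-- A homomorphism out of a model of class `7` is injective as soon as it is injective on the last
term of the lower central series. -/
lemma hom_injective (hθ : θ.ν ≠ 0 ∨ θ.ω ≠ 0) {L : Type*} [LieRing L] (φ : Model θ →ₗ⁅ℤ⁆ L)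
    (hφ : ∀ t, φ (zel θ t) = 0 → t = 0) : Function.Injective φ := by
  have ha : ∀ X, φ X = 0 → φ ⁅X, a θ⁆ = 0 := fun X h => by rw [LieHom.map_lie, h, zero_lie]
  have hb : ∀ X, φ X = 0 → φ ⁅X, b θ⁆ = 0 := fun X h => by rw [LieHom.map_lie, h, zero_lie]
  have k6 : ∀ g z, φ (em θ 0 0 0 0 g z) = 0 → g = 0 ∧ z = 0 := fun g z h => by
    have h1 := ha _ h
    have h2 := hb _ h
    rw [lie_a] at h1
    rw [lie_b] at h2
    simp only [co_em_zero, co_em_one, co_em_two, co_em_three, co_em_four, co_em_five, co_em_six,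
      mul_zero, add_zero, neg_zero, ← zel_apply] at h1 h2
    have hg : g = 0 := by
      rcases hθ with hθ | hθ
      · exact (mul_eq_zero.mp (hφ _ h1)).resolve_left hθ
      · exact (mul_eq_zero.mp (hφ _ h2)).resolve_left hθ
    subst hg
    exact ⟨rfl, hφ _ h⟩
  have k5 : ∀ f g z, φ (em θ 0 0 0 f g z) = 0 → f = 0 ∧ g = 0 ∧ z = 0 := fun f g z h => by
    have h1 := ha _ h
    rw [lie_a] at h1
    obtain rfl := (k6 _ _ h1).1
    exact ⟨rfl, k6 _ _ h⟩
  have k4 : ∀ e f g z, φ (em θ 0 0 e f g z) = 0 → e = 0 ∧ f = 0 ∧ g = 0 ∧ z = 0 :=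
    fun e f g z h => by
    have h1 := ha _ h
    rw [lie_a] at h1
    obtain rfl := (k5 _ _ _ h1).1
    exact ⟨rfl, k5 _ _ _ h⟩
  have k3 : ∀ d e f g z, φ (em θ 0 d e f g z) = 0 → d = 0 ∧ e = 0 ∧ f = 0 ∧ g = 0 ∧ z = 0 :=
    fun d e f g z h => by
    have h1 := ha _ h
    rw [lie_a] at h1
    obtain rfl := (k4 _ _ _ _ h1).1
    exact ⟨rfl, k4 _ _ _ _ h⟩
  have k2 : ∀ c d e f g z, φ (em θ c d e f g z) = 0 →
      c = 0 ∧ d = 0 ∧ e = 0 ∧ f = 0 ∧ g = 0 ∧ z = 0 :=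
    fun c d e f g z h => by
    have h1 := ha _ h
    rw [lie_a] at h1
    obtain rfl := (k3 _ _ _ _ _ h1).1
    exact ⟨rfl, k3 _ _ _ _ _ h⟩
  rw [injective_iff_map_eq_zero]
  intro X h
  have h1 := ha _ h
  have h0 := hb _ h
  rw [lie_a] at h1
  rw [lie_b] at h0
  have e1 := (k2 _ _ _ _ _ _ h1).1
  have e0 := neg_eq_zero.mp (k2 _ _ _ _ _ _ h0).1
  obtain ⟨z, hz⟩ := eq_em e0 e1
  rw [hz] at h ⊢
  obtain ⟨e2, e3, e4, e5, e6, e7⟩ := k2 _ _ _ _ _ _ h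
  rw [e2, e3, e4, e5, e6, e7, em_zero]

end Model

section
variable {p : ℕ} [hp : Fact p.Prime] {θ : Params p}
open Model

lemma Realizes.prod {L L' : Type*} [LieRing L] [LieRing L'] {a b : L} {ζ : ZMod p →+ L} {a' b' : L'}
    {ζ' : ZMod p →+ L'} (h : Realizes θ a b ζ) (h' : Realizes θ a' b' ζ') :
    Realizes θ (a, a') (b, b') (ζ.prod ζ') := by
  have hc : ∀ k, chain (a, a') (b, b') k = (chain a b k, chain a' b' k) := fun k => by
    induction k with
    | zero => rfl
    | succ k ih => rw [chain, ih]; rfl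
  constructor
  · exact fun t => Prod.ext (h.ζa t) (h'.ζa t)
  · exact fun t => Prod.ext (h.ζb t) (h'.ζb t)
  · rw [hc]; exact Prod.ext h.v5a h'.v5a
  · rw [hc]; exact Prod.ext h.v5b h'.v5b
  · rw [hc, hc]; exact Prod.ext h.v1b h'.v1b
  · rw [hc, hc]; exact Prod.ext h.v3b h'.v3b
  · exact Prod.ext h.pa h'.pa
  · exact Prod.ext h.pb h'.pb

/-- A Lie ring of order `p ^ 8` realizing `θ` is isomorphic to the model. -/
theorem Realizes.exists_equiv [hj : Fact ((3 - θ.x) * θ.ω = 0)] (hθ : θ.ν ≠ 0 ∨ θ.ω ≠ 0)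
    {L : Type*} [LieRing L] {a b : L} {ζ : ZMod p →+ L} (h : Realizes θ a b ζ)
    (hζ : Function.Injective ζ) (hL : Nat.card L = p ^ 8) :
    ∃ φ : Model θ →ₗ⁅ℤ⁆ L, Function.Bijective φ ∧ φ (Model.a θ) = a ∧ φ (Model.b θ) = b ∧
      ∀ t, φ (zel θ t) = ζ t := by
  have hP := h.prod (Model.realizes (θ := θ))
  set H : LieSubalgebra ℤ (L × Model θ) := LieSubalgebra.lieSpan ℤ (L × Model θ)
    {(a, Model.a θ), (b, Model.b θ)} with hH
  have haH : (a, Model.a θ) ∈ H := LieSubalgebra.subset_lieSpan (by simp)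
  have hbH : (b, Model.b θ) ∈ H := LieSubalgebra.subset_lieSpan (by simp)
  have hcard : Finite H ∧ Nat.card H ≤ p ^ 8 := by
    obtain ⟨hf, hc⟩ := hP.card_layer_le
    have hle : ∀ y : H, (y : L × Model θ) ∈ layer θ (a, Model.a θ) (b, Model.b θ)
        (ζ.prod (zel θ)) 0 := fun y =>
      hP.lieSpan_le_layer (LieSubalgebra.lieSpan_mono Set.subset_union_left y.2)
    let i : H → ↥(layer θ (a, Model.a θ) (b, Model.b θ) (ζ.prod (zel θ)) 0) := fun y => ⟨y, hle y⟩
    have hi : Function.Injective i := fun y z e =>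
      Subtype.ext (Subtype.mk.inj e)
    have hr : Nat.card (ζ.prod (zel θ)).range ≤ p := by
      have := Nat.card_le_card_of_surjective _ (AddMonoidHom.rangeRestrict_surjective
        (ζ.prod (zel θ)))
      rwa [Nat.card_zmod] at this
    refine ⟨Finite.of_injective i hi, (Nat.card_le_card_of_injective i hi).trans (hc.trans ?_)⟩
    calc _ ≤ p ^ 7 * p := by gcongr
      _ = p ^ 8 := by ring
  have := hcard.1
  let s : H →ₗ⁅ℤ⁆ Model θ := (LieHom.snd ℤ L (Model θ)).comp H.incl
  let f : H →ₗ⁅ℤ⁆ L := (LieHom.fst ℤ L (Model θ)).comp H.incl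
  have hs : Function.Surjective s := by
    rw [← LieHom.range_eq_top, eq_top_iff, ← lieSpan_eq_top hθ, LieSubalgebra.lieSpan_le]
    rintro y (rfl | rfl)
    · exact (LieHom.mem_range _ _).mpr ⟨⟨_, haH⟩, rfl⟩
    · exact (LieHom.mem_range _ _).mpr ⟨⟨_, hbH⟩, rfl⟩
  have hsb : Function.Bijective s :=
    (Nat.bijective_iff_surjective_and_card s).mpr ⟨hs, le_antisymm (hcard.2.trans_eq card_eq.symm)
      (Nat.card_le_card_of_surjective s hs)⟩
  let e : H ≃ₗ⁅ℤ⁆ Model θ := LieEquiv.ofBijective s hsb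
  let φ : Model θ →ₗ⁅ℤ⁆ L := f.comp (e.symm : Model θ →ₗ⁅ℤ⁆ H)
  have he : ∀ y : H, φ (s y) = f y := fun y => congrArg f (e.symm_apply_apply y)
  have hφa : φ (Model.a θ) = a := he ⟨_, haH⟩
  have hφb : φ (Model.b θ) = b := he ⟨_, hbH⟩
  have hM := (Model.realizes (θ := θ)).map φ
  rw [hφa, hφb] at hM
  have hφz : ∀ t, φ (zel θ t) = ζ t := fun t => by
    have key : ∀ s, s ≠ 0 → φ (zel θ s) = ζ s → φ (zel θ t) = ζ t := fun s hs h => by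
      have e1 : ∀ ξ : ZMod p →+ Model θ, ξ t = (t / s).val • ξ s := fun ξ => by
        rw [val_nsmul_map, div_mul_cancel₀ _ hs]
      have e2 : ζ t = (t / s).val • ζ s := by
        rw [val_nsmul_map, div_mul_cancel₀ _ hs]
      rw [e1, e2, map_nsmul, h]
    rcases hθ with hθ | hθ
    · exact key _ hθ (hM.v5a.symm.trans h.v5a)
    · exact key _ hθ (hM.v5b.symm.trans h.v5b)
  have hinj : Function.Injective φ := hom_injective hθ φ fun t ht => by
    rw [hφz] at ht
    exact hζ (ht.trans (map_zero ζ).symm)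
  have : Finite L := Nat.finite_of_card_ne_zero (by rw [hL]; exact pow_ne_zero _ hp.out.ne_zero)
  exact ⟨φ, (Nat.bijective_iff_injective_and_card φ).mpr ⟨hinj, by rw [card_eq, hL]⟩,
    hφa, hφb, hφz⟩

end
end MaxClass

namespace MaxClass

section
variable {L : Type*} [LieRing L]

/-- The Lie ring homomorphism from the free Lie ring sending the generators to `a` and `b`. -/
noncomputable def liftFL (a b : L) : FL →ₗ⁅ℤ⁆ L :=
  { ((FreeLieAlgebra.lift ℤ ![a, b] : FreeLieAlgebra ℤ (Fin 2) →+ L)).toIntLinearMap with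
    map_lie' := fun {x y} => (FreeLieAlgebra.lift ℤ ![a, b]).map_lie x y }

@[simp] lemma liftFL_ga (a b : L) : liftFL a b ga = a :=
  FreeLieAlgebra.lift_of_apply ![a, b] 0

@[simp] lemma liftFL_gb (a b : L) : liftFL a b gb = b :=
  FreeLieAlgebra.lift_of_apply ![a, b] 1

lemma FL_hom_ext {f g : FL →ₗ⁅ℤ⁆ L} (ha : f ga = g ga) (hb : f gb = g gb) : f = g := by
  apply FreeLieAlgebra.hom_ext
  intro i
  fin_cases i
  · exact ha
  · exact hb

lemma liftFL_mem {a b : L} {H : LieSubalgebra ℤ L} (ha : a ∈ H) (hb : b ∈ H) (w : FL) :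
    liftFL a b w ∈ H := by
  have : liftFL a b = H.incl.comp (liftFL (⟨a, ha⟩ : H) ⟨b, hb⟩) :=
    FL_hom_ext (by simp) (by simp)
  rw [this]
  exact (liftFL (⟨a, ha⟩ : H) ⟨b, hb⟩ w).2

lemma map_lowerCentralSeries {L' : Type*} [LieRing L'] (f : L →ₗ⁅ℤ⁆ L') (k : ℕ) {y : L}
    (hy : y ∈ LieModule.lowerCentralSeries ℤ L L k) :
    f y ∈ LieModule.lowerCentralSeries ℤ L' L' k :=
  LieIdeal.map_lowerCentralSeries_le k (LieIdeal.mem_map hy)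

/-- The projection onto the quotient by an ideal. -/
def proj (I : LieIdeal ℤ L) : L →ₗ⁅ℤ⁆ L ⧸ I :=
  { (LieSubmodule.Quotient.mk' I : L →ₗ[ℤ] L ⧸ I) with
    map_lie' := fun {x y} => LieSubmodule.Quotient.mk_bracket I x y }

lemma proj_surjective (I : LieIdeal ℤ L) : Function.Surjective (proj I) :=
  LieSubmodule.Quotient.surjective_mk' I

lemma proj_eq_zero {I : LieIdeal ℤ L} {y : L} : proj I y = 0 ↔ y ∈ I :=
  LieSubmodule.Quotient.mk_eq_zero I

/-- A homomorphism out of a quotient by an ideal. -/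
def quotLift {L' : Type*} [LieRing L'] (I : LieIdeal ℤ L) (f : L →ₗ⁅ℤ⁆ L') (h : ∀ y ∈ I, f y = 0) :
    L ⧸ I →ₗ⁅ℤ⁆ L' :=
  { I.toSubmodule.liftQ (f : L →ₗ[ℤ] L') h with
    map_lie' := fun {x y} => by
      obtain ⟨x, rfl⟩ := proj_surjective I x
      obtain ⟨y, rfl⟩ := proj_surjective I y
      rw [← LieHom.map_lie]
      exact f.map_lie x y }

end

section
variable {p : ℕ} [hp : Fact p.Prime] {L : Type*} [LieRing L]

/-- The members of the family. -/
abbrev Fam (p x : ℕ) : Type := presLie p {bab - ba3, ba3b - x • ba5}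

/-- The ideal of relations of a member of the family. -/
noncomputable abbrev famIdeal (p x : ℕ) : LieIdeal ℤ FL :=
  LieSubmodule.lieSpan ℤ FL ({bab - ba3, ba3b - x • ba5} ∪ {p • ga, p • gb}) ⊔
    LieModule.lowerCentralSeries ℤ FL FL 6

/-- The projection from the free Lie ring onto a member of the family. -/
noncomputable def famProj (p x : ℕ) : FL →ₗ⁅ℤ⁆ Fam p x := proj (famIdeal p x)

lemma famProj_surjective (p x : ℕ) : Function.Surjective (famProj p x) := proj_surjective _

lemma famProj_eq_zero {p x : ℕ} {w : FL} : famProj p x w = 0 ↔ w ∈ famIdeal p x := proj_eq_zero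

lemma gen_mem_famIdeal {p x : ℕ} {w : FL}
    (hw : w ∈ ({bab - ba3, ba3b - x • ba5} ∪ {p • ga, p • gb} : Set FL)) : w ∈ famIdeal p x :=
  (le_sup_left : LieSubmodule.lieSpan ℤ FL _ ≤ famIdeal p x) (LieSubmodule.subset_lieSpan hw)

lemma lcs_mem_famIdeal {p x : ℕ} {w : FL} (hw : w ∈ LieModule.lowerCentralSeries ℤ FL FL 6) :
    w ∈ famIdeal p x :=
  (le_sup_right : LieModule.lowerCentralSeries ℤ FL FL 6 ≤ famIdeal p x) hw

lemma famIdeal_eq_zero {p x : ℕ} (f : FL →ₗ⁅ℤ⁆ L) (h1 : f bab = f ba3) (h2 : f ba3b = x • f ba5)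
    (ha : p • f ga = 0) (hb : p • f gb = 0)
    (h6 : ∀ w ∈ LieModule.lowerCentralSeries ℤ FL FL 6, f w = 0) :
    ∀ w ∈ famIdeal p x, f w = 0 := by
  have : famIdeal p x ≤ f.ker := by
    refine sup_le ?_ fun w hw => (LieHom.mem_ker).mpr (h6 w hw)
    rw [LieSubmodule.lieSpan_le]
    rintro w ((rfl | rfl) | (rfl | rfl)) <;> rw [SetLike.mem_coe, LieHom.mem_ker]
    · rw [map_sub, h1, sub_self]
    · rw [map_sub, map_nsmul, h2, sub_self]
    · rw [map_nsmul, ha]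
    · rw [map_nsmul, hb]
  exact fun w hw => (LieHom.mem_ker).mp (this hw)

lemma chain_three_eq : chain ga gb 3 = ba3 := rfl
lemma chain_five_eq : chain ga gb 5 = ba5 := rfl
lemma chain_one_lie_eq : ⁅chain ga gb 1, gb⁆ = bab := rfl
lemma chain_three_lie_eq : ⁅chain ga gb 3, gb⁆ = ba3b := rfl

lemma realizes_fam {x : ℕ} (hx : x < p) :
    Realizes (⟨x, 0, 0, 0, 0, 0, 0⟩ : Params p) (famProj p x ga) (famProj p x gb) 0 where
  ζa t := by simp
  ζb t := by simp
  v5a := by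
    rw [← map_chain, ← LieHom.map_lie]
    exact famProj_eq_zero.mpr (lcs_mem_famIdeal
      (lie_mem_lowerCentralSeries _ (chain_mem_lowerCentralSeries _ _ 5)))
  v5b := by
    rw [← map_chain, ← LieHom.map_lie]
    exact famProj_eq_zero.mpr (lcs_mem_famIdeal
      (lie_mem_lowerCentralSeries _ (chain_mem_lowerCentralSeries _ _ 5)))
  v1b := by
    rw [← map_chain, ← map_chain, ← LieHom.map_lie, chain_one_lie_eq, chain_three_eq,
      AddMonoidHom.zero_apply, add_zero, ← sub_eq_zero, ← map_sub, famProj_eq_zero]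
    exact gen_mem_famIdeal (by simp)
  v3b := by
    rw [← map_chain, ← map_chain, ← LieHom.map_lie, chain_three_lie_eq, chain_five_eq,
      AddMonoidHom.zero_apply, add_zero, ZMod.val_natCast_of_lt hx, ← map_nsmul, ← sub_eq_zero,
      ← map_sub, famProj_eq_zero]
    exact gen_mem_famIdeal (by simp)
  pa := by
    rw [← map_nsmul, AddMonoidHom.zero_apply, famProj_eq_zero]
    exact gen_mem_famIdeal (by simp)
  pb := by
    rw [← map_nsmul, AddMonoidHom.zero_apply, famProj_eq_zero]
    exact gen_mem_famIdeal (by simp)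

lemma card_fam_le {x : ℕ} (hx : x < p) : Finite (Fam p x) ∧ Nat.card (Fam p x) ≤ p ^ 7 := by
  have h := realizes_fam hx
  obtain ⟨hf, hc⟩ := h.card_layer_le
  have hm : ∀ y : Fam p x, y ∈ layer _ (famProj p x ga) (famProj p x gb) 0 0 := fun y => by
    apply h.lieSpan_le_layer
    obtain ⟨w, rfl⟩ := famProj_surjective p x y
    have : famProj p x = liftFL (famProj p x ga) (famProj p x gb) :=
      FL_hom_ext (by simp) (by simp)
    rw [this, liftFL_ga, liftFL_gb]
    exact liftFL_mem (LieSubalgebra.subset_lieSpan (by simp))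
      (LieSubalgebra.subset_lieSpan (by simp)) w
  let i : Fam p x → ↥(layer _ (famProj p x ga) (famProj p x gb) 0 0) := fun y => ⟨y, hm y⟩
  have hi : Function.Injective i := fun y z e => Subtype.mk.inj e
  refine ⟨Finite.of_injective i hi, (Nat.card_le_card_of_injective i hi).trans (hc.trans_eq ?_)⟩
  have : (0 : ZMod p →+ Fam p x).range = ⊥ := by ext y; simp
  rw [this]
  simp

end

section
variable {p : ℕ} [hp : Fact p.Prime] {θ : Params p} [hj : Fact ((3 - θ.x) * θ.ω = 0)]
open Model

lemma Model.mem_lcs_six (hθ : θ.ν ≠ 0 ∨ θ.ω ≠ 0) (y : Model θ) :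
    y ∈ LieModule.lowerCentralSeries ℤ (Model θ) (Model θ) 6 ↔ ∃ t, y = zel θ t := by
  have hspan : LieSubalgebra.lieSpan ℤ (Model θ) ({a θ, b θ} ∪ Set.range (zel θ)) = ⊤ :=
    eq_top_iff.mpr ((lieSpan_eq_top hθ).symm.le.trans
      (LieSubalgebra.lieSpan_mono Set.subset_union_left))
  constructor
  · intro hy
    have h6 := realizes.lowerCentralSeries_le hspan 6 y hy
    have : layer θ (a θ) (b θ) (zel θ) 6 ≤ (zel θ).range := by
      rw [layer, AddSubgroup.closure_le]
      rintro y (⟨j, h1, h2, rfl⟩ | ⟨h1, rfl⟩ | ⟨h1, t, rfl⟩ | ⟨h1, rfl | rfl⟩)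
      · omega
      · omega
      · omega
      · exact ⟨_, rfl⟩
      · exact ⟨_, rfl⟩
    obtain ⟨t, rfl⟩ := this h6
    exact ⟨t, rfl⟩
  · rintro ⟨t, rfl⟩
    have key : ∀ s, s ≠ 0 → zel θ s ∈ LieModule.lowerCentralSeries ℤ (Model θ) (Model θ) 6 →
        zel θ t ∈ LieModule.lowerCentralSeries ℤ (Model θ) (Model θ) 6 := fun s hs h => by
      have : zel θ t = (t / s).val • zel θ s := by
        rw [val_nsmul_map, div_mul_cancel₀ _ hs]
      rw [this]; exact nsmul_mem h _
    rcases hθ with h | h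
    · exact key _ h ((realizes (θ := θ)).v5a ▸
        lie_mem_lowerCentralSeries _ (chain_mem_lowerCentralSeries _ _ 5))
    · exact key _ h ((realizes (θ := θ)).v5b ▸
        lie_mem_lowerCentralSeries _ (chain_mem_lowerCentralSeries _ _ 5))

lemma Model.lieClassEq (hθ : θ.ν ≠ 0 ∨ θ.ω ≠ 0) : LieClassEq (Model θ) 7 := by
  have hspan : LieSubalgebra.lieSpan ℤ (Model θ) ({a θ, b θ} ∪ Set.range (zel θ)) = ⊤ :=
    eq_top_iff.mpr ((lieSpan_eq_top hθ).symm.le.trans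
      (LieSubalgebra.lieSpan_mono Set.subset_union_left))
  constructor
  · rw [eq_bot_iff]
    intro y hy
    have h7 := realizes.lowerCentralSeries_le hspan 7 y hy
    rw [layer_seven] at h7
    exact (LieSubmodule.mem_bot y).mpr h7
  · intro h
    have h1 : zel θ 1 ∈ LieModule.lowerCentralSeries ℤ (Model θ) (Model θ) 6 :=
      (mem_lcs_six hθ _).mpr ⟨1, rfl⟩
    rw [h, LieSubmodule.mem_bot] at h1
    exact one_ne_zero (zel_injective (h1.trans (map_zero _).symm))

/-- The homomorphism from a member of the family to the quotient of the model. -/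
lemma Model.exists_fam_bijective (hθ : θ.ν ≠ 0 ∨ θ.ω ≠ 0) :
    ∃ φ : Fam p θ.x.val →ₗ⁅ℤ⁆
      Model θ ⧸ LieModule.lowerCentralSeries ℤ (Model θ) (Model θ) 6, Function.Bijective φ ∧
        Nat.card (Fam p θ.x.val) = p ^ 7 := by
  set I := LieModule.lowerCentralSeries ℤ (Model θ) (Model θ) 6 with hI
  have hz : ∀ t, proj I (zel θ t) = 0 := fun t => proj_eq_zero.mpr ((mem_lcs_six hθ _).mpr ⟨t, rfl⟩)
  have hR := realizes (θ := θ)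
  let f : FL →ₗ⁅ℤ⁆ Model θ := liftFL (a θ) (b θ)
  have hfc : ∀ k, f (chain ga gb k) = chain (a θ) (b θ) k := fun k => by
    rw [map_chain, liftFL_ga, liftFL_gb]
  let g : FL →ₗ⁅ℤ⁆ Model θ ⧸ I := (proj I).comp f
  have hg : ∀ w, g w = proj I (f w) := fun w => rfl
  have hker : ∀ w ∈ famIdeal p θ.x.val, g w = 0 := by
    apply famIdeal_eq_zero
    · rw [hg, hg, ← chain_one_lie_eq, ← chain_three_eq, LieHom.map_lie, hfc, hfc, liftFL_gb, hR.v1b,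
        map_add, hz, add_zero]
    · rw [hg, hg, ← chain_three_lie_eq, ← chain_five_eq, LieHom.map_lie, hfc, hfc, liftFL_gb,
        hR.v3b, map_add, hz, add_zero, map_nsmul]
    · rw [hg, liftFL_ga, ← map_nsmul, hR.pa, hz]
    · rw [hg, liftFL_gb, ← map_nsmul, hR.pb, hz]
    · intro w hw
      rw [hg, proj_eq_zero]
      exact map_lowerCentralSeries f 6 hw
  let φ : Fam p θ.x.val →ₗ⁅ℤ⁆ Model θ ⧸ I := quotLift (famIdeal p θ.x.val) g hker
  have hsurj : Function.Surjective φ := fun y => by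
    obtain ⟨m, rfl⟩ := proj_surjective I y
    have : m ∈ f.range := by
      have h : LieSubalgebra.lieSpan ℤ (Model θ) {a θ, b θ} ≤ f.range := by
        rw [LieSubalgebra.lieSpan_le]
        rintro y (rfl | rfl)
        · exact (LieHom.mem_range _ _).mpr ⟨ga, liftFL_ga _ _⟩
        · exact (LieHom.mem_range _ _).mpr ⟨gb, liftFL_gb _ _⟩
      rw [lieSpan_eq_top hθ] at h
      exact h (LieSubalgebra.mem_top m)
    obtain ⟨w, rfl⟩ := (LieHom.mem_range _ _).mp this
    exact ⟨famProj p θ.x.val w, rfl⟩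
  obtain ⟨hfin, hc⟩ := card_fam_le (ZMod.val_lt θ.x)
  have hcI : Nat.card I.toSubmodule = p := by
    have hb : Function.Bijective
        (fun t : ZMod p => (⟨zel θ t, (mem_lcs_six hθ _).mpr ⟨t, rfl⟩⟩ : I.toSubmodule)) :=
      ⟨fun s t h => zel_injective (Subtype.mk.inj h), fun ⟨y, hy⟩ => by
        obtain ⟨t, rfl⟩ := (mem_lcs_six hθ _).mp hy
        exact ⟨t, rfl⟩⟩
    rw [← Nat.card_eq_of_bijective _ hb, Nat.card_zmod]
  have hq : Nat.card (Model θ ⧸ I) = p ^ 7 := by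
    have h1 := I.toSubmodule.card_eq_card_quotient_mul_card
    rw [card_eq, hcI] at h1
    refine Nat.eq_of_mul_eq_mul_left hp.out.pos (Eq.trans h1.symm ?_)
    ring
  have hle := Nat.card_le_card_of_surjective φ hsurj
  have hcF : Nat.card (Fam p θ.x.val) = p ^ 7 := le_antisymm hc (hq ▸ hle)
  exact ⟨φ, (Nat.bijective_iff_surjective_and_card φ).mpr ⟨hsurj, hcF.trans hq.symm⟩, hcF⟩

end

lemma card_fam {p : ℕ} [hp : Fact p.Prime] {x : ℕ} (hx : x < p) : Nat.card (Fam p x) = p ^ 7 := by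
  let θ : Params p := ⟨x, 0, 0, 1, 0, 0, 0⟩
  have : Fact ((3 - θ.x) * θ.ω = 0) := ⟨mul_zero _⟩
  obtain ⟨φ, -, h⟩ := Model.exists_fam_bijective (θ := θ) (Or.inl one_ne_zero)
  rwa [ZMod.val_natCast_of_lt hx] at h

end MaxClass

namespace MaxClass

section isLieIso
variable {α β γ : Type*} [LieRing α] [LieRing β] [LieRing γ]

lemma isLieIso_of_bijective (φ : α →ₗ⁅ℤ⁆ β) (h : Function.Bijective φ) : IsLieIso α β :=
  ⟨Equiv.ofBijective φ h, fun x y => map_add φ x y, fun x y => LieHom.map_lie φ x y⟩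

lemma _root_.IsLieIso.exists_hom (h : IsLieIso α β) : ∃ φ : α →ₗ⁅ℤ⁆ β, Function.Bijective φ := by
  obtain ⟨e, h1, h2⟩ := h
  exact ⟨{ (AddMonoidHom.mk' e h1).toIntLinearMap with map_lie' := fun {x y} => h2 x y },
    e.bijective⟩

lemma _root_.IsLieIso.symm (h : IsLieIso α β) : IsLieIso β α := by
  obtain ⟨e, h1, h2⟩ := h
  exact ⟨e.symm, fun x y => by rw [Equiv.symm_apply_eq, h1]; simp,
    fun x y => by rw [Equiv.symm_apply_eq, h2]; simp⟩

lemma _root_.IsLieIso.trans (h : IsLieIso α β) (h' : IsLieIso β γ) : IsLieIso α γ := by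
  obtain ⟨e, h1, h2⟩ := h
  obtain ⟨f, h3, h4⟩ := h'
  exact ⟨e.trans f, fun x y => by simp [h1, h3], fun x y => by simp [h2, h4]⟩

end isLieIso

section
variable {p : ℕ} [hp : Fact p.Prime]

lemma exists_map_range_eq {L : Type*} [AddCommGroup L] (K : AddSubgroup L) (hK : Nat.card K = p) :
    ∃ ζ : ZMod p →+ L, Function.Injective ζ ∧ ∀ y, y ∈ K ↔ ∃ t, y = ζ t := by
  have hfin : Finite K := Nat.finite_of_card_ne_zero (by rw [hK]; exact hp.out.ne_zero)
  have : Nontrivial K := Finite.one_lt_card_iff_nontrivial.mp (by rw [hK]; exact hp.out.one_lt)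
  obtain ⟨z, hz⟩ := exists_ne (0 : K)
  have hpz : (p : ℤ) • (z : L) = 0 := by
    have h1 : Nat.card K • z = 0 := card_nsmul_eq_zero'
    rw [hK] at h1
    rw [natCast_zsmul]
    exact congrArg Subtype.val h1
  let ζ : ZMod p →+ L := ZMod.lift p ⟨zmultiplesHom L (z : L), by simpa using hpz⟩
  have hζ1 : ∀ n : ℤ, ζ n = n • (z : L) := fun n => by simp [ζ]
  have hζ : Function.Injective ζ := by
    rw [injective_iff_map_eq_zero]
    intro t ht
    by_contra h0
    have e : (1 : ZMod p) = (1 / t).val • t := by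
      rw [nsmul_eq_mul, ZMod.natCast_zmod_val, div_mul_cancel₀ _ h0]
    have h1 : ζ 1 = 0 := by rw [e, map_nsmul, ht, smul_zero]
    have h2 := hζ1 1
    rw [Int.cast_one, h1, one_smul] at h2
    exact hz (Subtype.ext h2.symm)
  have hmem : ∀ t, ζ t ∈ K := fun t => by
    obtain ⟨n, rfl⟩ := ZMod.intCast_surjective t
    rw [hζ1]
    exact zsmul_mem z.2 n
  have hb : Function.Bijective (fun t : ZMod p => (⟨ζ t, hmem t⟩ : K)) :=
    (Nat.bijective_iff_injective_and_card _).mpr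
      ⟨fun s t h => hζ (Subtype.mk.inj h), by rw [hK, Nat.card_zmod]⟩
  refine ⟨ζ, hζ, fun y => ⟨fun hy => ?_, ?_⟩⟩
  · obtain ⟨t, ht⟩ := hb.2 ⟨y, hy⟩
    exact ⟨t, (congrArg Subtype.val ht).symm⟩
  · rintro ⟨t, rfl⟩
    exact hmem t

/-- Every descendant of order `p ^ 8` realizes some structure constants. -/
theorem exists_realizes {L : Type*} [LieRing L] (hL : Nat.card L = p ^ 8) {x : ℕ} (hx : x < p)
    (h7 : LieClassEq L 7) (hiso : IsLieIso (L ⧸ LieModule.lowerCentralSeries ℤ L L 6) (Fam p x)) :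
    ∃ (θ : Params p) (a b : L) (ζ : ZMod p →+ L), (3 - θ.x) * θ.ω = 0 ∧ (θ.ν ≠ 0 ∨ θ.ω ≠ 0) ∧
      Function.Injective ζ ∧ Realizes θ a b ζ := by
  set I := LieModule.lowerCentralSeries ℤ L L 6 with hI
  have hfin : Finite L := Nat.finite_of_card_ne_zero (by rw [hL]; exact pow_ne_zero _ hp.out.ne_zero)
  have hcI : Nat.card I.toSubmodule.toAddSubgroup = p := by
    have h1 := I.toSubmodule.card_eq_card_quotient_mul_card
    obtain ⟨e, -⟩ := hiso
    have h2 : Nat.card (L ⧸ I.toSubmodule) = p ^ 7 := (Nat.card_congr e).trans (card_fam hx)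
    rw [hL, h2] at h1
    refine Nat.eq_of_mul_eq_mul_right (pow_pos hp.out.pos 7) (Eq.trans h1.symm ?_)
    ring
  obtain ⟨ζ, hζ, hmem⟩ := exists_map_range_eq I.toSubmodule.toAddSubgroup hcI
  replace hmem : ∀ y, y ∈ I ↔ ∃ t, y = ζ t := hmem
  have hcen : ∀ t (y : L), ⁅ζ t, y⁆ = 0 := fun t y => by
    have h := lie_mem_lowerCentralSeries y ((hmem _).mpr ⟨t, rfl⟩)
    rwa [h7.1, LieSubmodule.mem_bot] at h
  obtain ⟨ψ, hψ⟩ := hiso.symm.exists_hom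
  obtain ⟨a, ha⟩ := proj_surjective I (ψ (famProj p x ga))
  obtain ⟨b, hb⟩ := proj_surjective I (ψ (famProj p x gb))
  let f : FL →ₗ⁅ℤ⁆ L := liftFL a b
  have hfa : f ga = a := liftFL_ga a b
  have hfb : f gb = b := liftFL_gb a b
  have hcomp : (proj I).comp f = ψ.comp (famProj p x) :=
    FL_hom_ext (by simp [hfa, ha]) (by simp [hfb, hb])
  have hcomp' : ∀ w, proj I (f w) = ψ (famProj p x w) := fun w => LieHom.congr_fun hcomp w
  have hfc : ∀ k, f (chain ga gb k) = chain a b k := fun k => by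
    rw [map_chain, hfa, hfb]
  have hrel : ∀ w ∈ famIdeal p x, ∃ t, f w = ζ t := fun w hw => by
    rw [← hmem, ← proj_eq_zero, hcomp', famProj_eq_zero.mpr hw, map_zero]
  obtain ⟨r, hr⟩ := hrel (bab - ba3) (gen_mem_famIdeal (by simp))
  obtain ⟨q, hq⟩ := hrel (ba3b - x • ba5) (gen_mem_famIdeal (by simp))
  obtain ⟨γ, hγ⟩ := hrel (p • ga) (gen_mem_famIdeal (by simp))
  obtain ⟨δ, hδ⟩ := hrel (p • gb) (gen_mem_famIdeal (by simp))
  obtain ⟨ν, hν⟩ := (hmem _).mp (lie_mem_lowerCentralSeries a (chain_mem_lowerCentralSeries a b 5))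
  obtain ⟨ω, hω⟩ := (hmem _).mp (lie_mem_lowerCentralSeries b (chain_mem_lowerCentralSeries a b 5))
  let θ : Params p := ⟨x, r, q, ν, ω, γ, δ⟩
  have hR : Realizes θ a b ζ :=
    { ζa := fun t => hcen t a
      ζb := fun t => hcen t b
      v5a := hν
      v5b := hω
      v1b := by
        rw [map_sub, ← chain_one_lie_eq, ← chain_three_eq, LieHom.map_lie, hfc, hfc, hfb,
          sub_eq_iff_eq_add'] at hr
        exact hr
      v3b := by
        rw [map_sub, map_nsmul, ← chain_three_lie_eq, ← chain_five_eq, LieHom.map_lie, hfc, hfc,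
          hfb, sub_eq_iff_eq_add'] at hq
        rw [hq, ZMod.val_natCast_of_lt hx]
      pa := by rw [map_nsmul, hfa] at hγ; exact hγ
      pb := by rw [map_nsmul, hfb] at hδ; exact hδ }
  refine ⟨θ, a, b, ζ, hζ (hR.jacobi.trans (map_zero ζ).symm), ?_, hζ, hR⟩
  by_contra hne
  rw [not_or, not_not, not_not] at hne
  have hspan : LieSubalgebra.lieSpan ℤ L ({a, b} ∪ Set.range ζ) = ⊤ := by
    rw [eq_top_iff]
    intro y _
    obtain ⟨u, hu⟩ := hψ.2 (proj I y)
    obtain ⟨w, rfl⟩ := famProj_surjective p x u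
    rw [← hcomp', ← sub_eq_zero, ← map_sub, proj_eq_zero] at hu
    obtain ⟨t, ht⟩ := (hmem _).mp hu
    have hy : y = f w - ζ t := by rw [← ht]; abel
    rw [hy]
    exact sub_mem (liftFL_mem (LieSubalgebra.subset_lieSpan (by simp))
      (LieSubalgebra.subset_lieSpan (by simp)) w) (LieSubalgebra.subset_lieSpan (by simp))
  apply h7.2
  rw [eq_bot_iff]
  intro y hy
  have h6 := hR.lowerCentralSeries_le hspan 6 y hy
  have hbot : layer θ a b ζ 6 = ⊥ := by
    rw [layer, AddSubgroup.closure_eq_bot_iff]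
    rintro y (⟨j, h1, h2, rfl⟩ | ⟨h1, rfl⟩ | ⟨h1, t, rfl⟩ | ⟨h1, rfl | rfl⟩)
    · omega
    · omega
    · omega
    · rw [hne.1, map_zero]; rfl
    · rw [hne.2, map_zero]; rfl
  rw [hbot] at h6
  exact (LieSubmodule.mem_bot y).mpr h6

end
end MaxClass

namespace MaxClass

section torus
variable {p : ℕ} [hp : Fact p.Prime] {L : Type*} [LieRing L]

lemma chain_nsmul (a b : L) (n k : ℕ) :
    chain (n • a) (n ^ 2 • b) k = n ^ (k + 2) • chain a b k := by
  induction k with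
  | zero => rfl
  | succ k ih => rw [chain, ih, nsmul_lie, lie_nsmul, smul_smul, ← pow_succ]; rfl

lemma nsmul_map (ζ : ZMod p →+ L) (n : ℕ) (t : ZMod p) : n • ζ t = ζ (n * t) := by
  rw [← map_nsmul, nsmul_eq_mul]

lemma Realizes.scale {θ θ' : Params p} {a b : L} {ζ : ZMod p →+ L} (h : Realizes θ a b ζ)
    (n : ℕ) (m : ZMod p) (hx : θ'.x = θ.x) (hr : m * θ'.r = n ^ 5 * θ.r)
    (hq : m * θ'.q = n ^ 7 * θ.q) (hν : m * θ'.ν = n ^ 8 * θ.ν) (hω : m * θ'.ω = n ^ 9 * θ.ω)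
    (hγ : m * θ'.γ = n * θ.γ) (hδ : m * θ'.δ = n ^ 2 * θ.δ) :
    Realizes θ' (n • a) (n ^ 2 • b) (ζ.comp (AddMonoidHom.mulLeft m)) where
  ζa t := by rw [lie_nsmul]; simp [h.ζa]
  ζb t := by rw [lie_nsmul]; simp [h.ζb]
  v5a := by
    rw [chain_nsmul, nsmul_lie, lie_nsmul, smul_smul, h.v5a, nsmul_map]
    simp only [AddMonoidHom.comp_apply, AddMonoidHom.coe_mulLeft, hν]
    push_cast; ring_nf
  v5b := by
    rw [chain_nsmul, nsmul_lie, lie_nsmul, smul_smul, h.v5b, nsmul_map]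
    simp only [AddMonoidHom.comp_apply, AddMonoidHom.coe_mulLeft, hω]
    push_cast; ring_nf
  v1b := by
    rw [chain_nsmul, chain_nsmul, nsmul_lie, lie_nsmul, smul_smul, h.v1b, smul_add, nsmul_map]
    simp only [AddMonoidHom.comp_apply, AddMonoidHom.coe_mulLeft, hr]
    push_cast; ring_nf
  v3b := by
    rw [chain_nsmul, chain_nsmul, nsmul_lie, lie_nsmul, smul_smul, h.v3b, smul_add, nsmul_map, hx,
      smul_comm θ.x.val]
    simp only [AddMonoidHom.comp_apply, AddMonoidHom.coe_mulLeft, hq]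
    push_cast; ring_nf
  pa := by
    rw [smul_comm, h.pa, nsmul_map]
    simp only [AddMonoidHom.comp_apply, AddMonoidHom.coe_mulLeft, hγ]
  pb := by
    rw [smul_comm, h.pb, nsmul_map]
    simp only [AddMonoidHom.comp_apply, AddMonoidHom.coe_mulLeft, hδ]
    push_cast; rfl

lemma scale_injective {ζ : ZMod p →+ L} (hζ : Function.Injective ζ) {m : ZMod p} (hm : m ≠ 0) :
    Function.Injective (ζ.comp (AddMonoidHom.mulLeft m)) :=
  hζ.comp (mul_right_injective₀ hm)

end torus

/-- Structure constants in normal form. -/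
def Params.Normal {p : ℕ} (θ : Params p) : Prop :=
  (θ.ω = 0 ∧ θ.ν = 1 ∧ (θ.r = 0 ∨ θ.x = 1 ∧ θ.q = 0)) ∨ (θ.ω = 1 ∧ θ.x = 3 ∧ θ.r = 0)

/-- Structure constants of Lie rings of class `7`. -/
structure Params.Valid {p : ℕ} (θ : Params p) : Prop where
  jac : (3 - θ.x) * θ.ω = 0
  ne : θ.ν ≠ 0 ∨ θ.ω ≠ 0

section
variable {p : ℕ} [hp : Fact p.Prime]

lemma Params.Normal.valid {θ : Params p} (h : θ.Normal) : θ.Valid := by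
  rcases h with ⟨h1, h2, -⟩ | ⟨h1, h2, -⟩
  · exact ⟨by rw [h1, mul_zero], Or.inl (by rw [h2]; exact one_ne_zero)⟩
  · exact ⟨by rw [h2, sub_self, zero_mul], Or.inr (by rw [h1]; exact one_ne_zero)⟩

/-- Some generators of `L` satisfy the relations with structure constants `θ`. -/
def HasParams (L : Type*) [LieRing L] (θ : Params p) : Prop :=
  ∃ (a b : L) (ζ : ZMod p →+ L), Function.Injective ζ ∧ Realizes θ a b ζ

lemma HasParams.of_hom {L L' : Type*} [LieRing L] [LieRing L'] {θ : Params p} (h : HasParams L θ)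
    (φ : L →ₗ⁅ℤ⁆ L') (hφ : Function.Injective φ) : HasParams L' θ := by
  obtain ⟨a, b, ζ, hζ, hR⟩ := h
  exact ⟨_, _, _, hφ.comp hζ, hR.map φ⟩

lemma HasParams.exists_equiv {L : Type*} [LieRing L] {θ : Params p}
    [hj : Fact ((3 - θ.x) * θ.ω = 0)] (h : HasParams L θ)
    (hθ : θ.ν ≠ 0 ∨ θ.ω ≠ 0) (hL : Nat.card L = p ^ 8) :
    ∃ φ : Model θ →ₗ⁅ℤ⁆ L, Function.Bijective φ := by
  obtain ⟨a, b, ζ, hζ, hR⟩ := h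
  obtain ⟨φ, hφ, -⟩ := hR.exists_equiv hθ hζ hL
  exact ⟨φ, hφ⟩

namespace Model
variable {θ : Params p} [hj : Fact ((3 - θ.x) * θ.ω = 0)]

lemma lie_eq (X Y : Model θ) : ⁅X, Y⁆ =
    let w := fun i j => X.co i * Y.co j - X.co j * Y.co i
    em θ (w 1 0) (w 2 0) (w 3 0 + w 2 1) (w 4 0 + w 3 1)
      (w 5 0 + θ.x * w 4 1 + (1 - θ.x) * w 3 2)
      (θ.ν * w 6 0 + θ.ω * w 6 1 + θ.r * w 2 1 + θ.q * w 4 1 + (2 * θ.x - 1) * θ.ν * w 5 1 -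
        θ.q * w 3 2 + (1 - θ.x) * θ.ν * w 4 2 - θ.ω * w 5 2 + θ.ω * w 4 3) := rfl

lemma em_lie (c d e f g z : ZMod p) (Y : Model θ) : ⁅em θ c d e f g z, Y⁆ =
    em θ 0 (c * Y.co 0) (d * Y.co 0 + c * Y.co 1) (e * Y.co 0 + d * Y.co 1)
      (f * Y.co 0 + θ.x * (e * Y.co 1) + (1 - θ.x) * (d * Y.co 2 - Y.co 3 * c))
      (θ.ν * (g * Y.co 0) + θ.ω * (g * Y.co 1) + θ.r * (c * Y.co 1) + θ.q * (e * Y.co 1) +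
        (2 * θ.x - 1) * θ.ν * (f * Y.co 1) - θ.q * (d * Y.co 2 - c * Y.co 3) +
        (1 - θ.x) * θ.ν * (e * Y.co 2 - c * Y.co 4) - θ.ω * (f * Y.co 2 - c * Y.co 5) +
        θ.ω * (e * Y.co 3 - d * Y.co 4)) := by
  rw [lie_eq]
  simp only [co_em_zero, co_em_one, co_em_two, co_em_three, co_em_four, co_em_five, co_em_six]
  congr 1 <;> ring

end Model

open Model

section shift
variable {θ : Params p} [hj : Fact ((3 - θ.x) * θ.ω = 0)]

lemma hasParams_shift_a_four (hx : θ.x = 3) (s : ZMod p) :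
    HasParams (Model θ) { θ with r := θ.r - 2 * s * θ.ω } := by
  set A : Model θ := ofCo θ ![1, 0, 0, 0, s, 0, 0] with hA
  have h0 : A.co 0 = 1 := rfl
  have h1 : A.co 1 = 0 := rfl
  have h2 : A.co 2 = 0 := rfl
  have h3 : A.co 3 = 0 := rfl
  have h4 : A.co 4 = s := rfl
  have h5 : A.co 5 = 0 := rfl
  have h6 : A.co 6 = 0 := rfl
  have c1 : chain A (b θ) 1 = em θ 1 0 0 0 (-θ.x * s) (-θ.q * s) := by
    rw [chain, chain, lie_eq]
    simp only [h0, h1, h2, h3, h4, h5, h6, co_b_zero, co_b_one, co_b_two, co_b_three, co_b_four,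
      co_b_five, co_b_six]
    congr 1 <;> ring
  have c2 : chain A (b θ) 2 = em θ 0 1 0 0 0 (-θ.ν * s) := by
    rw [chain, c1, em_lie]
    simp only [h0, h1, h2, h3, h4, h5]
    congr 1 <;> ring
  have c3 : chain A (b θ) 3 = em θ 0 0 1 0 0 (-θ.ω * s) := by
    rw [chain, c2, em_lie]
    simp only [h0, h1, h2, h3, h4, h5]
    congr 1 <;> ring
  have c4 : chain A (b θ) 4 = em θ 0 0 0 1 0 0 := by
    rw [chain, c3, em_lie]
    simp only [h0, h1, h2, h3, h4, h5]
    congr 1 <;> ring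
  have c5 : chain A (b θ) 5 = em θ 0 0 0 0 1 0 := by
    rw [chain, c4, em_lie]
    simp only [h0, h1, h2, h3, h4, h5]
    congr 1 <;> ring
  refine ⟨A, b θ, zel θ, zel_injective, ⟨fun t => zel_lie t _, fun t => zel_lie t _, ?_, ?_, ?_, ?_,
    ?_, ?_⟩⟩
  · rw [c5, em_lie, zel_apply]
    simp only [h0, h1, h2, h3, h4, h5]
    congr 1 <;> ring
  · rw [c5, em_lie, zel_apply]
    simp only [co_b_zero, co_b_one, co_b_two, co_b_three, co_b_four, co_b_five]
    congr 1 <;> ring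
  · rw [c1, c3, em_lie, zel_apply, em_add]
    simp only [co_b_zero, co_b_one, co_b_two, co_b_three, co_b_four, co_b_five, hx]
    congr 1 <;> ring
  · rw [c3, c5, em_lie, zel_apply, em_nsmul, em_add, ZMod.natCast_zmod_val]
    simp only [co_b_zero, co_b_one, co_b_two, co_b_three, co_b_four, co_b_five]
    congr 1 <;> ring
  · rw [p_nsmul, h0, h1]; simp
  · rw [p_nsmul]; simp

lemma hasParams_shift_a_three (hω : θ.ω = 0) (s : ZMod p) :
    HasParams (Model θ) { θ with r := θ.r + 3 * s * (1 - θ.x) * θ.ν } := by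
  set A : Model θ := ofCo θ ![1, 0, 0, s, 0, 0, 0] with hA
  have h0 : A.co 0 = 1 := rfl
  have h1 : A.co 1 = 0 := rfl
  have h2 : A.co 2 = 0 := rfl
  have h3 : A.co 3 = s := rfl
  have h4 : A.co 4 = 0 := rfl
  have h5 : A.co 5 = 0 := rfl
  have h6 : A.co 6 = 0 := rfl
  have c1 : chain A (b θ) 1 = em θ 1 0 0 (-s) 0 0 := by
    rw [chain, chain, lie_eq]
    simp only [h0, h1, h2, h3, h4, h5, h6, co_b_zero, co_b_one, co_b_two, co_b_three, co_b_four,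
      co_b_five, co_b_six]
    congr 1 <;> ring
  have c2 : chain A (b θ) 2 = em θ 0 1 0 0 (-s - (1 - θ.x) * s) (θ.q * s) := by
    rw [chain, c1, em_lie]
    simp only [h0, h1, h2, h3, h4, h5, hω]
    congr 1 <;> ring
  have c3 : chain A (b θ) 3 = em θ 0 0 1 0 0 (-θ.ν * s * (2 - θ.x)) := by
    rw [chain, c2, em_lie]
    simp only [h0, h1, h2, h3, h4, h5, hω]
    congr 1 <;> ring
  have c4 : chain A (b θ) 4 = em θ 0 0 0 1 0 0 := by
    rw [chain, c3, em_lie]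
    simp only [h0, h1, h2, h3, h4, h5, hω]
    congr 1 <;> ring
  have c5 : chain A (b θ) 5 = em θ 0 0 0 0 1 0 := by
    rw [chain, c4, em_lie]
    simp only [h0, h1, h2, h3, h4, h5, hω]
    congr 1 <;> ring
  refine ⟨A, b θ, zel θ, zel_injective, ⟨fun t => zel_lie t _, fun t => zel_lie t _, ?_, ?_, ?_, ?_,
    ?_, ?_⟩⟩
  · rw [c5, em_lie, zel_apply]
    simp only [h0, h1, h2, h3, h4, h5]
    congr 1 <;> ring
  · rw [c5, em_lie, zel_apply]
    simp only [co_b_zero, co_b_one, co_b_two, co_b_three, co_b_four, co_b_five]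
    congr 1 <;> ring
  · rw [c1, c3, em_lie, zel_apply, em_add]
    simp only [co_b_zero, co_b_one, co_b_two, co_b_three, co_b_four, co_b_five, hω]
    congr 1 <;> ring
  · rw [c3, c5, em_lie, zel_apply, em_nsmul, em_add, ZMod.natCast_zmod_val]
    simp only [co_b_zero, co_b_one, co_b_two, co_b_three, co_b_four, co_b_five]
    congr 1 <;> ring
  · rw [p_nsmul, h0, h1]; simp
  · rw [p_nsmul]; simp

lemma hasParams_shift_b_three (hω : θ.ω = 0) (hx : θ.x = 1) (t : ZMod p) :
    HasParams (Model θ) { θ with r := θ.r + 2 * t * θ.q } := by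
  set B : Model θ := ofCo θ ![0, 1, 0, t, 0, 0, 0] with hB
  have h0 : B.co 0 = 0 := rfl
  have h1 : B.co 1 = 1 := rfl
  have h2 : B.co 2 = 0 := rfl
  have h3 : B.co 3 = t := rfl
  have h4 : B.co 4 = 0 := rfl
  have h5 : B.co 5 = 0 := rfl
  have h6 : B.co 6 = 0 := rfl
  have c1 : chain (a θ) B 1 = em θ 1 0 t 0 0 0 := by
    rw [chain, chain, lie_a]
    simp only [h1, h2, h3, h4, h5, h6]
    congr 1; ring
  have c2 : chain (a θ) B 2 = em θ 0 1 0 t 0 0 := by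
    rw [chain, c1, lie_a]
    simp
  have c3 : chain (a θ) B 3 = em θ 0 0 1 0 t 0 := by
    rw [chain, c2, lie_a]
    simp
  have c4 : chain (a θ) B 4 = em θ 0 0 0 1 0 (θ.ν * t) := by
    rw [chain, c3, lie_a]
    simp
  have c5 : chain (a θ) B 5 = em θ 0 0 0 0 1 0 := by
    rw [chain, c4, lie_a]
    simp
  refine ⟨a θ, B, zel θ, zel_injective, ⟨fun t => zel_lie t _, fun t => zel_lie t _, ?_, ?_, ?_, ?_,
    ?_, ?_⟩⟩
  · rw [c5, lie_a, zel_apply]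
    simp
  · rw [c5, em_lie, zel_apply]
    simp only [h0, h1, h2, h3, h4, h5]
    congr 1 <;> ring
  · rw [c1, c3, em_lie, zel_apply, em_add]
    simp only [h0, h1, h2, h3, h4, h5, hω, hx]
    congr 1 <;> ring
  · rw [c3, c5, em_lie, zel_apply, em_nsmul, em_add, ZMod.natCast_zmod_val]
    simp only [h0, h1, h2, h3, h4, h5, hω, hx]
    congr 1 <;> ring
  · rw [p_nsmul]; simp
  · rw [p_nsmul, h0, h1]; simp

end shift

end
end MaxClass

namespace MaxClass

section
variable {p : ℕ} [hp : Fact p.Prime]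

lemma two_ne_zero_of_five_le (h5 : 5 ≤ p) : (2 : ZMod p) ≠ 0 := by
  have := (ZMod.natCast_eq_zero_iff 2 p).not.mpr
    (fun h => absurd (Nat.le_of_dvd (by norm_num) h) (by omega))
  exact_mod_cast this

lemma three_ne_zero_of_five_le (h5 : 5 ≤ p) : (3 : ZMod p) ≠ 0 := by
  have := (ZMod.natCast_eq_zero_iff 3 p).not.mpr
    (fun h => absurd (Nat.le_of_dvd (by norm_num) h) (by omega))
  exact_mod_cast this

lemma HasParams.div {L : Type*} [LieRing L] {θ : Params p} (h : HasParams L θ) {m : ZMod p}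
    (hm : m ≠ 0) : HasParams L
      ⟨θ.x, θ.r / m, θ.q / m, θ.ν / m, θ.ω / m, θ.γ / m, θ.δ / m⟩ := by
  obtain ⟨a, b, ζ, hζ, hR⟩ := h
  refine ⟨_, _, _, scale_injective hζ hm, hR.scale 1 m rfl ?_ ?_ ?_ ?_ ?_ ?_⟩ <;>
    simp [mul_div_cancel₀ _ hm]

lemma HasParams.of_model {L : Type*} [LieRing L] {θ θ' : Params p}
    [Fact ((3 - θ.x) * θ.ω = 0)] (h : HasParams L θ) (hv : θ.Valid) (hL : Nat.card L = p ^ 8)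
    (h' : HasParams (Model θ) θ') : HasParams L θ' := by
  obtain ⟨φ, hφ⟩ := h.exists_equiv hv.ne hL
  exact h'.of_hom φ hφ.1

lemma HasParams.exists_normal {L : Type*} [LieRing L] {θ : Params p} (h : HasParams L θ)
    (h5 : 5 ≤ p) (hv : θ.Valid) (hL : Nat.card L = p ^ 8) :
    ∃ θ' : Params p, θ'.Normal ∧ HasParams L θ' := by
  have h2 := two_ne_zero_of_five_le (p := p) h5
  have h3 := three_ne_zero_of_five_le (p := p) h5
  by_cases hω : θ.ω = 0
  · have hν : θ.ν ≠ 0 := hv.ne.resolve_right (not_not_intro hω)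
    have h1 := h.div hν
    set θ₁ : Params p := ⟨θ.x, θ.r / θ.ν, θ.q / θ.ν, θ.ν / θ.ν, θ.ω / θ.ν, θ.γ / θ.ν, θ.δ / θ.ν⟩
    have e1 : θ₁.ω = 0 := by simp [θ₁, hω]
    have e2 : θ₁.ν = 1 := div_self hν
    have hv1 : θ₁.Valid := ⟨by rw [e1, mul_zero], Or.inl (by rw [e2]; exact one_ne_zero)⟩
    have : Fact ((3 - θ₁.x) * θ₁.ω = 0) := ⟨hv1.jac⟩
    by_cases hx : θ₁.x = 1
    · by_cases hq : θ₁.q = 0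
      · exact ⟨θ₁, Or.inl ⟨e1, e2, Or.inr ⟨hx, hq⟩⟩, h1⟩
      · refine ⟨_, Or.inl ⟨?_, ?_, Or.inl ?_⟩, h1.of_model hv1 hL
          (hasParams_shift_b_three e1 hx (-θ₁.r / (2 * θ₁.q)))⟩
        · exact e1
        · exact e2
        · change θ₁.r + 2 * (-θ₁.r / (2 * θ₁.q)) * θ₁.q = 0
          field_simp
          ring
    · refine ⟨_, Or.inl ⟨?_, ?_, Or.inl ?_⟩, h1.of_model hv1 hL
          (hasParams_shift_a_three e1 (-θ₁.r / (3 * (1 - θ₁.x))))⟩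
      · exact e1
      · exact e2
      · have hx' : 1 - θ₁.x ≠ 0 := sub_ne_zero.mpr (Ne.symm hx)
        change θ₁.r + 3 * (-θ₁.r / (3 * (1 - θ₁.x))) * (1 - θ₁.x) * θ₁.ν = 0
        rw [e2]
        field_simp
        ring
  · have h1 := h.div hω
    set θ₁ : Params p := ⟨θ.x, θ.r / θ.ω, θ.q / θ.ω, θ.ν / θ.ω, θ.ω / θ.ω, θ.γ / θ.ω, θ.δ / θ.ω⟩
    have e1 : θ₁.ω = 1 := div_self hω
    have e2 : θ₁.x = 3 :=
      (sub_eq_zero.mp ((mul_eq_zero.mp hv.jac).resolve_right hω)).symm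
    have hv1 : θ₁.Valid := ⟨by rw [e2, sub_self, zero_mul], Or.inr (by rw [e1]; exact one_ne_zero)⟩
    have : Fact ((3 - θ₁.x) * θ₁.ω = 0) := ⟨hv1.jac⟩
    refine ⟨_, Or.inr ⟨?_, ?_, ?_⟩, h1.of_model hv1 hL
          (hasParams_shift_a_four e2 (θ₁.r / 2))⟩
    · exact e1
    · exact e2
    · change θ₁.r - 2 * (θ₁.r / 2) * θ₁.ω = 0
      rw [e1]
      field_simp
      ring

end
end MaxClass

namespace MaxClass

section
variable {p : ℕ} [hp : Fact p.Prime]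

namespace Model
variable {θ : Params p} [hj : Fact ((3 - θ.x) * θ.ω = 0)]

section
variable (X Y : Model θ)

lemma co_lie_zero : ⁅X, Y⁆.co 0 = 0 := rfl
lemma co_lie_one : ⁅X, Y⁆.co 1 = 0 := rfl
lemma co_lie_two : ⁅X, Y⁆.co 2 = X.co 1 * Y.co 0 - X.co 0 * Y.co 1 := rfl
lemma co_lie_three : ⁅X, Y⁆.co 3 = X.co 2 * Y.co 0 - X.co 0 * Y.co 2 := rfl
lemma co_lie_four : ⁅X, Y⁆.co 4 =
    X.co 3 * Y.co 0 - X.co 0 * Y.co 3 + (X.co 2 * Y.co 1 - X.co 1 * Y.co 2) := rfl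
lemma co_lie_five : ⁅X, Y⁆.co 5 =
    X.co 4 * Y.co 0 - X.co 0 * Y.co 4 + (X.co 3 * Y.co 1 - X.co 1 * Y.co 3) := rfl
lemma co_lie_six : ⁅X, Y⁆.co 6 = X.co 5 * Y.co 0 - X.co 0 * Y.co 5 +
    θ.x * (X.co 4 * Y.co 1 - X.co 1 * Y.co 4) +
      (1 - θ.x) * (X.co 3 * Y.co 2 - X.co 2 * Y.co 3) := rfl

end

section
variable (A B : Model θ)

lemma chain_five_eq_em : ∃ z, chain A B 5 = em θ 0 0 0 0
    ((B.co 1 * A.co 0 - B.co 0 * A.co 1) * A.co 0 ^ 4) z := by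
  obtain ⟨z, hz⟩ := eq_em (X := chain A B 5) rfl rfl
  refine ⟨z, hz.trans ?_⟩
  congr 1 <;>
  · simp only [chain, co_lie_zero, co_lie_one, co_lie_two, co_lie_three, co_lie_four, co_lie_five,
      co_lie_six]
    ring

lemma chain_five_lie (Y : Model θ) : ⁅chain A B 5, Y⁆ =
    zel θ ((B.co 1 * A.co 0 - B.co 0 * A.co 1) * A.co 0 ^ 4 * (θ.ν * Y.co 0 + θ.ω * Y.co 1)) := by
  obtain ⟨z, hz⟩ := chain_five_eq_em A B
  rw [hz, em_lie, zel_apply]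
  congr 1 <;> ring

end

variable {θ' : Params p} {A B : Model θ} {ζ : ZMod p →+ Model θ}

lemma exists_eq_zel (h : Realizes θ' A B ζ) (hn : θ'.Normal) :
    ∃ k, (∀ t, ζ t = zel θ (k * t)) ∧
      k * θ'.ν = (B.co 1 * A.co 0 - B.co 0 * A.co 1) * A.co 0 ^ 4 *
        (θ.ν * A.co 0 + θ.ω * A.co 1) ∧
      k * θ'.ω = (B.co 1 * A.co 0 - B.co 0 * A.co 1) * A.co 0 ^ 4 *
        (θ.ν * B.co 0 + θ.ω * B.co 1) ∧
      k * θ'.γ = θ.γ * A.co 0 + θ.δ * A.co 1 ∧ k * θ'.δ = θ.γ * B.co 0 + θ.δ * B.co 1 := by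
  have ea := h.v5a
  have eb := h.v5b
  have pa := h.pa
  have pb := h.pb
  rw [chain_five_lie] at ea eb
  rw [p_nsmul] at pa pb
  obtain ⟨k, hk⟩ : ∃ k, ζ 1 = zel θ k := by
    rcases hn with ⟨-, h1, -⟩ | ⟨h1, -⟩
    · rw [h1] at ea; exact ⟨_, ea.symm⟩
    · rw [h1] at eb; exact ⟨_, eb.symm⟩
  have hζ : ∀ t, ζ t = zel θ (k * t) := fun t => by
    have := val_nsmul_map ζ t 1
    rw [mul_one] at this
    rw [← this, hk, val_nsmul_map, mul_comm]
  refine ⟨k, hζ, ?_, ?_, ?_, ?_⟩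
  · rw [hζ] at ea; exact (zel_injective ea).symm
  · rw [hζ] at eb; exact (zel_injective eb).symm
  · rw [hζ] at pa; exact (zel_injective pa).symm
  · rw [hζ] at pb; exact (zel_injective pb).symm

lemma co_of_realizes (h : Realizes θ' A B ζ) (hn : θ'.Normal) (hζ : Function.Injective ζ) :
    A.co 0 ≠ 0 ∧ B.co 0 = 0 ∧ B.co 1 = A.co 0 ^ 2 := by
  obtain ⟨k, hk, hν, hω, -⟩ := exists_eq_zel h hn
  have hD : (B.co 1 * A.co 0 - B.co 0 * A.co 1) * A.co 0 ^ 4 ≠ 0 := by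
    intro hD
    rw [hD, zero_mul] at hν hω
    have : k = 0 := by
      rcases hn with ⟨-, h1, -⟩ | ⟨h1, -⟩
      · rwa [h1, mul_one] at hν
      · rwa [h1, mul_one] at hω
    rw [this] at hk
    exact one_ne_zero (hζ ((hk 1).trans ((by simp : _ = zel θ (0 * 0)).trans (hk 0).symm)))
  obtain ⟨hD, hA⟩ := mul_ne_zero_iff.mp hD
  have hA := ne_zero_pow (by norm_num) hA
  have e := h.v1b
  rw [hk, zel_apply] at e
  have e3 := congrArg (fun X => co X 3) e
  have e4 := congrArg (fun X => co X 4) e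
  simp only [chain, co_add, co_em_three, co_em_four, co_lie_zero, co_lie_one, co_lie_two,
    co_lie_three, co_lie_four] at e3 e4
  have hB : B.co 0 = 0 := by
    refine mul_left_cancel₀ hD ?_
    linear_combination e3
  refine ⟨hA, hB, mul_left_cancel₀ hD ?_⟩
  rw [hB] at e4 ⊢
  linear_combination e4

lemma co_one_of_realizes (h : Realizes θ' A B ζ) (hn : θ'.Normal) (h2 : (2 : ZMod p) ≠ 0)
    (hA : A.co 0 = 1) (hB0 : B.co 0 = 0) (hB1 : B.co 1 = 1) : A.co 1 = 0 := by
  obtain ⟨k, hk, -⟩ := exists_eq_zel h hn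
  have e := h.v1b
  rw [hk, zel_apply] at e
  have e5 := congrArg (fun X => co X 5) e
  simp only [chain, co_add, co_em_five, co_lie_zero, co_lie_one, co_lie_two,
    co_lie_three, co_lie_four, co_lie_five, hA, hB0, hB1] at e5
  refine (mul_eq_zero.mp ?_).resolve_left h2
  linear_combination -e5

end Model
end
end MaxClass

namespace MaxClass
namespace Model

section
variable {p : ℕ} [hp : Fact p.Prime]
variable {θ : Params p} [hj : Fact ((3 - θ.x) * θ.ω = 0)]
variable {θ' : Params p} {A B : Model θ} {ζ : ZMod p →+ Model θ}

lemma eq_of_realizes (h : Realizes θ' A B ζ) (h5 : 5 ≤ p) (hn : θ.Normal) (hn' : θ'.Normal)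
    (hA0 : A.co 0 = 1) (hB0 : B.co 0 = 0) (hB1 : B.co 1 = 1) : θ' = θ := by
  have h2 := two_ne_zero_of_five_le h5
  have h3 := three_ne_zero_of_five_le h5
  have hA1 := co_one_of_realizes h hn' h2 hA0 hB0 hB1
  obtain ⟨k, hk, hν, hω, hγ, hδ⟩ := exists_eq_zel h hn'
  simp only [hA0, hA1, hB0, hB1] at hν hω hγ hδ
  obtain rfl : k = 1 := by
    rcases hn with ⟨h1, h2, -⟩ | ⟨h1, -⟩ <;> rcases hn' with ⟨h1', h2', -⟩ | ⟨h1', -⟩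
    · rw [h2, h2'] at hν; linear_combination hν
    · rw [h1, h1'] at hω
      obtain rfl : k = 0 := by linear_combination hω
      rw [h2] at hν
      exact absurd (by linear_combination -hν) (one_ne_zero (α := ZMod p))
    · rw [h1, h1'] at hω
      exact absurd (by linear_combination -hω) (one_ne_zero (α := ZMod p))
    · rw [h1, h1'] at hω; linear_combination hω
  have c1 : chain A B 1 = _ := lie_eq B A
  simp only [hA0, hA1, hB0, hB1] at c1
  have c2 := congrArg (fun X => ⁅X, A⁆) c1
  simp only [em_lie, chain_succ, hA0, hA1] at c2
  have c3 := congrArg (fun X => ⁅X, A⁆) c2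
  simp only [em_lie, chain_succ, hA0, hA1] at c3
  have c4 := congrArg (fun X => ⁅X, A⁆) c3
  simp only [em_lie, chain_succ, hA0, hA1] at c4
  have c5 := congrArg (fun X => ⁅X, A⁆) c4
  simp only [em_lie, chain_succ, hA0, hA1] at c5
  have e1 := h.v1b
  have e3 := h.v3b
  rw [hk, zel_apply, c1, em_lie, c3, em_add, em_inj] at e1
  rw [hk, zel_apply, c3, em_lie, c5, em_nsmul, em_add, em_inj, ZMod.natCast_zmod_val] at e3
  simp only [hB0, hB1] at e1 e3
  obtain ⟨-, -, -, -, e16, e17⟩ := e1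
  obtain ⟨-, -, -, -, e36, e37⟩ := e3
  clear c1 c2 c3 c4 c5
  have hν' : θ'.ν = θ.ν := by linear_combination hν
  have hω' : θ'.ω = θ.ω := by linear_combination hω
  have hx' : θ'.x = θ.x := by linear_combination -e36
  have hγ' : θ'.γ = θ.γ := by linear_combination hγ
  have hδ' : θ'.δ = θ.δ := by linear_combination hδ
  rcases hn with ⟨h1, hn2, hn3⟩ | ⟨h1, hn2, hn3⟩
  · rw [hx', h1, hn2] at e37
    have hq' : θ'.q = θ.q := by linear_combination -e37
    refine Params.ext hx' ?_ hq' hν' hω' hγ' hδ'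
    by_cases hxq : θ.x = 1 ∧ θ.q = 0
    · rw [hxq.1, hxq.2, h1, hn2] at e17
      linear_combination -e17
    · have hr : θ.r = 0 := hn3.resolve_right hxq
      rcases hn' with ⟨-, -, hr' | h'⟩ | ⟨h1', -⟩
      · rw [hr, hr']
      · rw [hx', hq'] at h'
        exact absurd h' hxq
      · rw [hω', h1] at h1'
        exact absurd h1'.symm one_ne_zero
  · refine Params.ext hx' ?_ ?_ hν' hω' hγ' hδ'
    · rcases hn' with ⟨h1', -⟩ | ⟨-, -, hr'⟩
      · rw [hω', h1] at h1'
        exact absurd h1' one_ne_zero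
      · rw [hr', hn3]
    · rw [hx', h1, hn2] at e37
      rw [hn2] at e16
      refine mul_left_cancel₀ h2 ?_
      linear_combination e16 - 2 * e37

end
end Model
end MaxClass

namespace MaxClass

/-- The normal forms: those with `ω = 0` and `r = 0`, those with `ω = 0` and `r ≠ 0`,
and those with `ω = 1`. -/
inductive NormalForm (p : ℕ) : Type
  | generic (x q γ δ : ZMod p)
  | special (r : (ZMod p)ˣ) (γ δ : ZMod p)
  | three (ν q γ δ : ZMod p)

namespace NormalForm
variable {p : ℕ}

/-- The structure constants belonging to a normal form. -/
def params : NormalForm p → Params p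
  | generic x q γ δ => ⟨x, 0, q, 1, 0, γ, δ⟩
  | special r γ δ => ⟨1, r, 0, 1, 0, γ, δ⟩
  | three ν q γ δ => ⟨3, 0, q, ν, 1, γ, δ⟩

/-- The action of diagonal changes of generators on the normal forms. -/
def act (l : (ZMod p)ˣ) : NormalForm p → NormalForm p
  | generic x q γ δ => generic x (l * q) (l ^ 7 * γ) (l ^ 6 * δ)
  | special r γ δ => special (l ^ 3 * r) (l ^ 7 * γ) (l ^ 6 * δ)
  | three ν q γ δ => three (l * ν) (l ^ 2 * q) (l ^ 8 * γ) (l ^ 7 * δ)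

instance : MulAction (ZMod p)ˣ (NormalForm p) where
  smul := act
  one_smul n := by
    change act 1 n = n
    cases n <;> simp [act]
  mul_smul k l n := by
    change act (k * l) n = act k (act l n)
    cases n <;> simp [act, mul_pow, mul_assoc]

lemma smul_generic (l : (ZMod p)ˣ) (x q γ δ : ZMod p) :
    l • generic x q γ δ = generic x (l.val * q) (l.val ^ 7 * γ) (l.val ^ 6 * δ) := rfl

lemma smul_special (l r : (ZMod p)ˣ) (γ δ : ZMod p) :
    l • special r γ δ = special (l ^ 3 * r) (l.val ^ 7 * γ) (l.val ^ 6 * δ) := rfl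

lemma smul_three (l : (ZMod p)ˣ) (ν q γ δ : ZMod p) :
    l • three ν q γ δ = three (l.val * ν) (l.val ^ 2 * q) (l.val ^ 8 * γ) (l.val ^ 7 * δ) := rfl

lemma params_injective [Fact p.Prime] : Function.Injective (params (p := p)) := by
  rintro (⟨x, q, γ, δ⟩ | ⟨r, γ, δ⟩ | ⟨ν, q, γ, δ⟩) (⟨x', q', γ', δ'⟩ | ⟨r', γ', δ'⟩ | ⟨ν', q', γ', δ'⟩) h <;>
    simp only [params, Params.mk.injEq] at h
  · obtain ⟨rfl, -, rfl, -, -, rfl, rfl⟩ := h; rfl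
  · exact absurd h.2.1.symm r'.ne_zero
  · exact absurd h.2.2.2.2.1 zero_ne_one
  · exact absurd h.2.1 r.ne_zero
  · obtain ⟨-, hr, -, -, -, rfl, rfl⟩ := h; rw [Units.ext hr]
  · exact absurd h.2.2.2.2.1 zero_ne_one
  · exact absurd h.2.2.2.2.1 one_ne_zero
  · exact absurd h.2.2.2.2.1 one_ne_zero
  · obtain ⟨-, -, rfl, rfl, -, rfl, rfl⟩ := h; rfl

lemma normal_params (n : NormalForm p) : n.params.Normal := by
  rcases n with ⟨x, q, γ, δ⟩ | ⟨r, γ, δ⟩ | ⟨ν, q, γ, δ⟩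
  · exact Or.inl ⟨rfl, rfl, Or.inl rfl⟩
  · exact Or.inl ⟨rfl, rfl, Or.inr ⟨rfl, rfl⟩⟩
  · exact Or.inr ⟨rfl, rfl, rfl⟩

lemma exists_params_eq [Fact p.Prime] {θ : Params p} (h : θ.Normal) : ∃ n : NormalForm p, n.params = θ := by
  obtain ⟨x, r, q, ν, ω, γ, δ⟩ := θ
  by_cases hr : r = 0
  · rcases h with ⟨h1, h2, -⟩ | ⟨h1, h2, -⟩
    · exact ⟨generic x q γ δ, by simp_all [params]⟩
    · exact ⟨three ν q γ δ, by simp_all [params]⟩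
  · rcases h with ⟨h1, h2, h3⟩ | ⟨-, -, h3⟩
    · exact ⟨special (Units.mk0 r hr) γ δ, by simp_all [params]⟩
    · exact absurd h3 hr

variable [hp : Fact p.Prime]

instance (n : NormalForm p) : Fact ((3 - n.params.x) * n.params.ω = 0) :=
  ⟨n.normal_params.valid.jac⟩

lemma exists_realizes_smul {L : Type*} [LieRing L] {n : NormalForm p} {a b : L} {ζ : ZMod p →+ L}
    (h : Realizes n.params a b ζ) (hζ : Function.Injective ζ) (l : (ZMod p)ˣ) :
    ∃ ζ' : ZMod p →+ L, Function.Injective ζ' ∧ Realizes (l • n).params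
      ((l⁻¹ : (ZMod p)ˣ).val.val • a) ((l⁻¹ : (ZMod p)ˣ).val.val ^ 2 • b) ζ' := by
  have key : ∀ i j, ((l⁻¹ : (ZMod p)ˣ) : ZMod p) ^ (i + j) * l ^ i = (l⁻¹ : (ZMod p)ˣ) ^ j := by
    intro i j
    rw [pow_add, mul_right_comm, ← mul_pow, Units.inv_mul, one_pow, one_mul]
  have e (k : ℕ) : ((l⁻¹ : (ZMod p)ˣ) : ZMod p) ^ k ≠ 0 := pow_ne_zero _ (Units.ne_zero _)
  rcases n with ⟨x, q, γ, δ⟩ | ⟨r, γ, δ⟩ | ⟨ν, q, γ, δ⟩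
  · refine ⟨_, scale_injective hζ (e 8), h.scale _ _ rfl ?_ ?_ ?_ ?_ ?_ ?_⟩ <;>
      rw [ZMod.natCast_zmod_val] <;> simp only [smul_generic, params, mul_zero, ← mul_assoc]
    · linear_combination q * key 1 7
    · linear_combination γ * key 7 1
    · linear_combination δ * key 6 2
  · refine ⟨_, scale_injective hζ (e 8), h.scale _ _ rfl ?_ ?_ ?_ ?_ ?_ ?_⟩ <;>
      rw [ZMod.natCast_zmod_val] <;>
      simp only [smul_special, params, mul_zero, ← mul_assoc, Units.val_mul, Units.val_pow_eq_pow_val]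
    · linear_combination r * key 3 5
    · linear_combination γ * key 7 1
    · linear_combination δ * key 6 2
  · refine ⟨_, scale_injective hζ (e 9), h.scale _ _ rfl ?_ ?_ ?_ ?_ ?_ ?_⟩ <;>
      rw [ZMod.natCast_zmod_val] <;> simp only [smul_three, params, mul_zero, ← mul_assoc]
    · linear_combination q * key 2 7
    · linear_combination ν * key 1 8
    · linear_combination γ * key 8 1
    · linear_combination δ * key 7 2

lemma hasParams_smul {L : Type*} [LieRing L] {n : NormalForm p} (h : HasParams L n.params)
    (l : (ZMod p)ˣ) : HasParams L (l • n).params := by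
  obtain ⟨a, b, ζ, hζ, h⟩ := h
  obtain ⟨ζ', hζ', h'⟩ := exists_realizes_smul h hζ l
  exact ⟨_, _, _, hζ', h'⟩

lemma exists_smul_eq_of_hasParams (h5 : 5 ≤ p) {n n' : NormalForm p}
    (h : HasParams (Model n.params) n'.params) : ∃ l : (ZMod p)ˣ, l • n' = n := by
  obtain ⟨a, b, ζ, hζ, h⟩ := h
  obtain ⟨ha, hb0, hb1⟩ := Model.co_of_realizes h n'.normal_params hζ
  refine ⟨Units.mk0 _ ha, params_injective ?_⟩
  obtain ⟨ζ', hζ', h'⟩ := exists_realizes_smul h hζ (Units.mk0 _ ha)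
  refine Model.eq_of_realizes h' h5 n.normal_params (normal_params _) ?_ ?_ ?_
  · simp [ha]
  · simp [hb0]
  · simp [hb1, ha]

lemma exists_bijective {L : Type*} [LieRing L] {n : NormalForm p} (h : HasParams L n.params)
    (hL : Nat.card L = p ^ 8) : ∃ φ : Model n.params →ₗ⁅ℤ⁆ L, Function.Bijective φ :=
  h.exists_equiv n.normal_params.valid.ne hL

lemma isLieIso_iff {L L' : Type*} [LieRing L] [LieRing L'] (h5 : 5 ≤ p) {n n' : NormalForm p}
    (h : HasParams L n.params) (h' : HasParams L' n'.params)
    (hL : Nat.card L = p ^ 8) (hL' : Nat.card L' = p ^ 8) :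
    IsLieIso L L' ↔ ∃ l : (ZMod p)ˣ, l • n' = n := by
  obtain ⟨φ, hφ⟩ := exists_bijective h hL
  constructor
  · intro hi
    obtain ⟨ψ, hψ⟩ := ((isLieIso_of_bijective φ hφ).trans hi).symm.exists_hom
    exact exists_smul_eq_of_hasParams h5 (h'.of_hom ψ hψ.1)
  · rintro ⟨l, rfl⟩
    obtain ⟨ψ, hψ⟩ := exists_bijective (hasParams_smul h' l) hL'
    exact (isLieIso_of_bijective φ hφ).symm.trans (isLieIso_of_bijective ψ hψ)

end NormalForm
end MaxClass

namespace MaxClass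

section
variable {p : ℕ} [hp : Fact p.Prime]

lemma card_pow_eq_one (w : ℕ) :
    Nat.card {l : (ZMod p)ˣ // l ^ w = 1} = Nat.gcd (p - 1) w := by
  have h := IsCyclic.card_powMonoidHom_ker (G := (ZMod p)ˣ) w
  rw [Nat.card_eq_fintype_card (α := (ZMod p)ˣ), ZMod.card_units] at h
  rw [← h]
  exact Nat.card_congr (Equiv.subtypeEquivRight fun l => by simp [MonoidHom.mem_ker])

lemma sum_ite_pow_eq_one (w : ℕ) :
    ∑ l : (ZMod p)ˣ, (if l ^ w = 1 then (1 : ℤ) else 0) = (Nat.gcd (p - 1) w : ℤ) := by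
  rw [← card_pow_eq_one, Nat.card_eq_fintype_card, Fintype.card_subtype]
  simp

lemma card_mul_eq_self (c : (ZMod p)ˣ) :
    Nat.card {t : ZMod p // c.val * t = t} = if c = 1 then p else 1 := by
  split_ifs with h
  · subst h
    rw [Nat.card_congr (Equiv.subtypeUnivEquiv fun t => by simp), Nat.card_zmod]
  · have : Unique {t : ZMod p // c.val * t = t} :=
      { default := ⟨0, mul_zero _⟩
        uniq := fun ⟨t, ht⟩ => Subtype.ext (by
          by_contra h0
          exact h (Units.ext (mul_right_cancel₀ h0 (ht.trans (one_mul t).symm)))) }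
    exact Nat.card_unique

lemma card_units_mul_eq_self (c : (ZMod p)ˣ) :
    Nat.card {t : (ZMod p)ˣ // c * t = t} = if c = 1 then p - 1 else 0 := by
  split_ifs with h
  · subst h
    rw [Nat.card_congr (Equiv.subtypeUnivEquiv fun t => one_mul t), Nat.card_eq_fintype_card,
      ZMod.card_units]
  · have : IsEmpty {t : (ZMod p)ˣ // c * t = t} := ⟨fun t => h (mul_eq_right.mp t.2)⟩
    exact Nat.card_of_isEmpty

namespace NormalForm

/-- The fixed points of `l` in terms of coordinates. -/
def fixedByEquiv (l : (ZMod p)ˣ) : MulAction.fixedBy (NormalForm p) l ≃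
    (ZMod p × {t : ZMod p // (l ^ 1).val * t = t} × {t : ZMod p // (l ^ 7).val * t = t} ×
      {t : ZMod p // (l ^ 6).val * t = t}) ⊕
    ({t : (ZMod p)ˣ // l ^ 3 * t = t} × {t : ZMod p // (l ^ 7).val * t = t} ×
      {t : ZMod p // (l ^ 6).val * t = t}) ⊕
    ({t : ZMod p // (l ^ 1).val * t = t} × {t : ZMod p // (l ^ 2).val * t = t} ×
      {t : ZMod p // (l ^ 8).val * t = t} × {t : ZMod p // (l ^ 7).val * t = t}) where
  toFun
    | ⟨generic x q γ δ, h⟩ => .inl (by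
        rw [MulAction.mem_fixedBy, smul_generic, generic.injEq] at h
        exact ⟨x, ⟨q, by simpa using h.2.1⟩, ⟨γ, by simpa using h.2.2.1⟩, ⟨δ, by simpa using h.2.2.2⟩⟩)
    | ⟨special r γ δ, h⟩ => .inr (.inl (by
        rw [MulAction.mem_fixedBy, smul_special, special.injEq] at h
        exact ⟨⟨r, h.1⟩, ⟨γ, by simpa using h.2.1⟩, ⟨δ, by simpa using h.2.2⟩⟩))
    | ⟨three ν q γ δ, h⟩ => .inr (.inr (by
        rw [MulAction.mem_fixedBy, smul_three, three.injEq] at h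
        exact ⟨⟨ν, by simpa using h.1⟩, ⟨q, by simpa using h.2.1⟩, ⟨γ, by simpa using h.2.2.1⟩,
          ⟨δ, by simpa using h.2.2.2⟩⟩))
  invFun
    | .inl (x, ⟨q, h1⟩, ⟨γ, h2⟩, ⟨δ, h3⟩) => ⟨generic x q γ δ, by
        rw [Units.val_pow_eq_pow_val] at h1 h2 h3
        rw [pow_one] at h1
        rw [MulAction.mem_fixedBy, smul_generic, h1, h2, h3]⟩
    | .inr (.inl (⟨r, h1⟩, ⟨γ, h2⟩, ⟨δ, h3⟩)) => ⟨special r γ δ, by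
        rw [Units.val_pow_eq_pow_val] at h2 h3
        rw [MulAction.mem_fixedBy, smul_special, h1, h2, h3]⟩
    | .inr (.inr (⟨ν, h0⟩, ⟨q, h1⟩, ⟨γ, h2⟩, ⟨δ, h3⟩)) => ⟨three ν q γ δ, by
        rw [Units.val_pow_eq_pow_val] at h0 h1 h2 h3
        rw [pow_one] at h0
        rw [MulAction.mem_fixedBy, smul_three, h0, h1, h2, h3]⟩
  left_inv := by rintro ⟨_ | _ | _, h⟩ <;> rfl
  right_inv := by rintro (_ | _ | _) <;> rfl

instance : Finite (NormalForm p) :=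
  Finite.of_equiv _ ((Equiv.subtypeUnivEquiv fun n => one_smul _ n).symm.trans
    (fixedByEquiv (1 : (ZMod p)ˣ))).symm

lemma card_fixedBy (l : (ZMod p)ˣ) : Nat.card (MulAction.fixedBy (NormalForm p) l) =
    p * ((if l ^ 1 = 1 then p else 1) * ((if l ^ 7 = 1 then p else 1) * (if l ^ 6 = 1 then p else 1)))
    + ((if l ^ 3 = 1 then p - 1 else 0) * ((if l ^ 7 = 1 then p else 1) * (if l ^ 6 = 1 then p else 1))
    + (if l ^ 1 = 1 then p else 1) * ((if l ^ 2 = 1 then p else 1) *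
      ((if l ^ 8 = 1 then p else 1) * (if l ^ 7 = 1 then p else 1)))) := by
  rw [Nat.card_congr (fixedByEquiv l), Nat.card_sum, Nat.card_sum]
  simp only [Nat.card_prod, card_mul_eq_self, card_units_mul_eq_self, Nat.card_zmod]

lemma card_fixedBy_eq (l : (ZMod p)ˣ) : (Nat.card (MulAction.fixedBy (NormalForm p) l) : ℤ) =
    p + 1 + (p - 1) * (p * (if l ^ 7 = 1 then 1 else 0) + p * (if l ^ 6 = 1 then 1 else 0) +
      p * (if l ^ 3 = 1 then 1 else 0) + (if l ^ 7 = 1 then 1 else 0) +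
      (if l ^ 8 = 1 then 1 else 0) + p * (if l ^ 2 = 1 then 1 else 0)) +
    (p - 1) * (2 * p ^ 3 + 3 * p ^ 2 - 2 * p - 1) * (if l ^ 1 = 1 then 1 else 0) := by
  have key : ∀ i j : ℕ, i.Coprime j → l ^ i = 1 → l ^ j = 1 → l ^ 1 = 1 := fun i j hij hi hj => by
    rw [← hij]
    exact orderOf_dvd_iff_pow_eq_one.mp
      (Nat.dvd_gcd (orderOf_dvd_of_pow_eq_one hi) (orderOf_dvd_of_pow_eq_one hj))
  have h1 : 1 ≤ p := hp.out.one_lt.le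
  rw [card_fixedBy]
  by_cases e1 : l ^ 1 = 1
  · have : l = 1 := by simpa using e1
    subst this
    simp only [one_pow, if_true]
    push_cast [h1]
    ring
  · have d3 : l ^ 3 = 1 → l ^ 6 = 1 := fun h => by rw [pow_mul l 3 2, h, one_pow]
    have d6 : l ^ 2 = 1 → l ^ 6 = 1 := fun h => by rw [pow_mul l 2 3, h, one_pow]
    have d8 : l ^ 2 = 1 → l ^ 8 = 1 := fun h => by rw [pow_mul l 2 4, h, one_pow]
    have d2 : l ^ 6 = 1 → l ^ 8 = 1 → l ^ 2 = 1 := fun h h' => by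
      rw [pow_add l 6 2, h, one_mul] at h'; exact h'
    have k76 := key 7 6 (by norm_num)
    have k73 := key 7 3 (by norm_num)
    have k72 := key 7 2 (by norm_num)
    have k78 := key 7 8 (by norm_num)
    have k32 := key 3 2 (by norm_num)
    have k38 := key 3 8 (by norm_num)
    by_cases e7 : l ^ 7 = 1
    · rw [if_neg e1, if_pos e7, if_neg fun h => e1 (k76 e7 h), if_neg fun h => e1 (k73 e7 h),
        if_neg fun h => e1 (k72 e7 h), if_neg fun h => e1 (k78 e7 h)]
      simp only [if_pos e7, if_neg e1, if_neg fun h => e1 (k76 e7 h),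
        if_neg fun h => e1 (k73 e7 h), if_neg fun h => e1 (k72 e7 h), if_neg fun h => e1 (k78 e7 h)]
      push_cast
      ring
    · by_cases e2 : l ^ 2 = 1
      · have e3 : l ^ 3 ≠ 1 := fun h => e1 (k32 h e2)
        simp only [if_neg e1, if_pos e2, if_pos (d6 e2), if_pos (d8 e2), if_neg e3, if_neg e7]
        push_cast
        ring
      · by_cases e3 : l ^ 3 = 1
        · have e8 : l ^ 8 ≠ 1 := fun h => e1 (k38 e3 h)
          simp only [if_neg e1, if_pos e3, if_pos (d3 e3), if_neg e8, if_neg e2, if_neg e7]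
          push_cast [h1]
          ring
        · by_cases e6 : l ^ 6 = 1
          · have e8 : l ^ 8 ≠ 1 := fun h => e2 (d2 e6 h)
            simp only [if_neg e1, if_neg e3, if_pos e6, if_neg e8, if_neg e2, if_neg e7]
            push_cast
            ring
          · by_cases e8 : l ^ 8 = 1
            · simp only [if_neg e1, if_neg e3, if_neg e6, if_pos e8, if_neg e2, if_neg e7]
              push_cast
              ring
            · simp only [if_neg e1, if_neg e3, if_neg e6, if_neg e8, if_neg e2, if_neg e7]
              push_cast
              ring

lemma card_orbits (h5 : 5 ≤ p) :
    Nat.card (MulAction.orbitRel.Quotient (ZMod p)ˣ (NormalForm p)) =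
    2 * p ^ 3 + 3 * p ^ 2 + p + 3 * p * Nat.gcd (p - 1) 3 +
      (p + 1) * Nat.gcd (p - 1) 7 + Nat.gcd (p - 1) 8 := by
  classical
  have := Fintype.ofFinite (NormalForm p)
  have := Fintype.ofFinite (MulAction.orbitRel.Quotient (ZMod p)ˣ (NormalForm p))
  have hB := MulAction.sum_card_fixedBy_eq_card_orbits_mul_card_group (ZMod p)ˣ (NormalForm p)
  have g1 : Nat.gcd (p - 1) 1 = 1 := Nat.gcd_one_right _
  have g2 : Nat.gcd (p - 1) 2 = 2 := by
    refine Nat.gcd_eq_right (even_iff_two_dvd.mp ?_)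
    exact hp.out.even_sub_one (by omega)
  have g6 : Nat.gcd (p - 1) 6 = 2 * Nat.gcd (p - 1) 3 := by
    rw [show 6 = 2 * 3 from rfl, Nat.Coprime.gcd_mul _ (by norm_num), g2]
  have h1 : 1 ≤ p := hp.out.one_lt.le
  have hn : ((p - 1 : ℕ) : ℤ) ≠ 0 := by omega
  have hc : Nat.card (ZMod p)ˣ = p - 1 := by rw [Nat.card_eq_fintype_card, ZMod.card_units]
  zify at hB
  simp only [← Nat.card_eq_fintype_card, card_fixedBy_eq, Finset.sum_add_distrib,
    ← Finset.mul_sum, sum_ite_pow_eq_one, g1, g2, g6, Finset.sum_const, Finset.card_univ,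
    hc, nsmul_eq_mul] at hB
  zify
  refine mul_right_cancel₀ hn (Eq.trans hB.symm ?_)
  push_cast [h1]
  ring

end NormalForm
end
end MaxClass

namespace MaxClass

section transfer
variable {L L' : Type*} [LieRing L] [LieRing L'] (φ : L →ₗ⁅ℤ⁆ L')

lemma mem_lowerCentralSeries_iff (hφ : Function.Bijective φ) (k : ℕ) (y : L) :
    φ y ∈ LieModule.lowerCentralSeries ℤ L' L' k ↔ y ∈ LieModule.lowerCentralSeries ℤ L L k := by
  refine ⟨fun h => ?_, map_lowerCentralSeries φ k⟩
  let e := LieEquiv.ofBijective φ hφ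
  have h1 := map_lowerCentralSeries e.symm.toLieHom k h
  have h2 : e.symm.toLieHom (φ y) = y := e.symm_apply_apply y
  rwa [h2] at h1

lemma lowerCentralSeries_eq_bot_iff (hφ : Function.Bijective φ) (k : ℕ) :
    LieModule.lowerCentralSeries ℤ L' L' k = ⊥ ↔ LieModule.lowerCentralSeries ℤ L L k = ⊥ := by
  simp only [LieSubmodule.eq_bot_iff]
  constructor
  · intro h y hy
    exact hφ.1 ((h _ (map_lowerCentralSeries φ k hy)).trans (map_zero φ).symm)
  · intro h y hy
    obtain ⟨y, rfl⟩ := hφ.2 y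
    rw [h y ((mem_lowerCentralSeries_iff φ hφ k y).mp hy), map_zero]

lemma _root_.LieClassEq.of_bijective (hφ : Function.Bijective φ) {c : ℕ} (h : LieClassEq L c) : LieClassEq L' c :=
  ⟨(lowerCentralSeries_eq_bot_iff φ hφ _).mpr h.1,
    fun h' => h.2 ((lowerCentralSeries_eq_bot_iff φ hφ _).mp h')⟩

lemma isLieIso_quotient_lowerCentralSeries (hφ : Function.Bijective φ) (k : ℕ) :
    IsLieIso (L ⧸ LieModule.lowerCentralSeries ℤ L L k)
      (L' ⧸ LieModule.lowerCentralSeries ℤ L' L' k) := by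
  have hmem := mem_lowerCentralSeries_iff φ hφ k
  set I := LieModule.lowerCentralSeries ℤ L L k
  set I' := LieModule.lowerCentralSeries ℤ L' L' k
  refine isLieIso_of_bijective (quotLift I ((proj I').comp φ)
    fun y hy => proj_eq_zero.mpr ((hmem y).mpr hy)) ⟨?_, fun u => ?_⟩
  · rw [injective_iff_map_eq_zero]
    intro u hu
    obtain ⟨y, rfl⟩ := proj_surjective I u
    exact proj_eq_zero.mpr ((hmem y).mp (proj_eq_zero.mp hu))
  · obtain ⟨y, rfl⟩ := proj_surjective I' u
    obtain ⟨y, rfl⟩ := hφ.2 y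
    exact ⟨proj I y, rfl⟩

end transfer

section
variable {p : ℕ} [hp : Fact p.Prime]

/-- A Lie ring on `Fin (p ^ 8)` is a descendant of a member of the family. -/
def IsFamDescendant (s : LieRing (Fin (p ^ 8))) : Prop :=
  ∃ x : ℕ, x < p ∧ IsMaxClassDescendantOf p (Fam p x) s

/-- A Lie ring structure on `Fin (p ^ 8)` is described by a normal form. -/
def HasNormalForm (s : LieRing (Fin (p ^ 8))) (n : NormalForm p) : Prop :=
  @HasParams p hp (Fin (p ^ 8)) s n.params

lemma IsFamDescendant.exists_hasNormalForm (h5 : 5 ≤ p) {s : LieRing (Fin (p ^ 8))}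
    (h : IsFamDescendant s) : ∃ n, HasNormalForm s n := by
  let := s
  obtain ⟨x, hx, h7, hiso⟩ := h
  have hL : Nat.card (Fin (p ^ 8)) = p ^ 8 := Nat.card_fin _
  obtain ⟨θ, a, b, ζ, hj, hne, hζ, hR⟩ := exists_realizes hL hx h7 hiso
  obtain ⟨θ', hn, h'⟩ := HasParams.exists_normal ⟨a, b, ζ, hζ, hR⟩ h5 ⟨hj, hne⟩ hL
  obtain ⟨n, rfl⟩ := NormalForm.exists_params_eq hn
  exact ⟨n, h'⟩

lemma NormalForm.exists_isFamDescendant (n : NormalForm p) :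
    ∃ s : LieRing (Fin (p ^ 8)), IsFamDescendant s ∧ HasNormalForm s n := by
  let e : Fin (p ^ 8) ≃ Model n.params := (Finite.equivFinOfCardEq Model.card_eq).symm
  let s : LieRing (Fin (p ^ 8)) := e.lieRing
  obtain ⟨φ, hφ⟩ : ∃ φ : Model n.params →ₗ⁅ℤ⁆ Fin (p ^ 8), Function.Bijective φ :=
    (IsLieIso.symm (α := Fin (p ^ 8)) (β := Model n.params)
      ⟨e, fun x y => e.apply_symm_apply _, fun x y => e.apply_symm_apply _⟩).exists_hom
  have hne := n.normal_params.valid.ne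
  obtain ⟨ψ, hψ, -⟩ := Model.exists_fam_bijective hne
  refine ⟨s, ⟨n.params.x.val, ZMod.val_lt _, (Model.lieClassEq hne).of_bijective φ hφ,
    ((isLieIso_of_bijective ψ hψ).trans (isLieIso_quotient_lowerCentralSeries φ hφ 6)).symm⟩, ?_⟩
  exact HasParams.of_hom ⟨_, _, _, Model.zel_injective, Model.realizes⟩ φ hφ.1

lemma HasNormalForm.isLieIso_iff (h5 : 5 ≤ p) {s t : LieRing (Fin (p ^ 8))} {m n : NormalForm p}
    (hs : HasNormalForm s m) (ht : HasNormalForm t n) :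
    @IsLieIso _ _ s t ↔ MulAction.orbitRel (ZMod p)ˣ (NormalForm p) m n :=
  @NormalForm.isLieIso_iff p hp _ _ s t h5 m n hs ht (Nat.card_fin _) (Nat.card_fin _)

lemma card_isFamDescendant (h5 : 5 ≤ p) :
    Nat.card (Quot fun s t : {s : LieRing (Fin (p ^ 8)) // IsFamDescendant s} =>
      @IsLieIso _ _ s.1 t.1) =
    Nat.card (MulAction.orbitRel.Quotient (ZMod p)ˣ (NormalForm p)) := by
  choose n hn using fun s : {s : LieRing (Fin (p ^ 8)) // IsFamDescendant s} =>
    s.2.exists_hasNormalForm h5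
  refine Nat.card_congr (Equiv.ofBijective
    (Quot.lift (fun s => Quotient.mk (MulAction.orbitRel _ _) (n s))
      fun s t h => Quotient.sound (((hn s).isLieIso_iff h5 (hn t)).mp h)) ⟨?_, ?_⟩)
  · rintro ⟨s⟩ ⟨t⟩ h
    exact Quot.sound (((hn s).isLieIso_iff h5 (hn t)).mpr (Quotient.exact h))
  · rintro ⟨m⟩
    obtain ⟨s, hs, hm⟩ := m.exists_isFamDescendant
    refine ⟨Quot.mk _ ⟨s, hs⟩, Quotient.sound (((hn ⟨s, hs⟩).isLieIso_iff h5 hm).mp ?_)⟩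
    exact ⟨Equiv.refl _, fun _ _ => rfl, fun _ _ => rfl⟩

end
end MaxClass

/-- The family 7.650 : for `0 ≤ x < p`, `M_x = ⟨a,b | [b,a,b]-[b,a,a,a],
[b,a,a,a,b]-x[b,a,a,a,a,a], pa, pb, class 6⟩`.  Between them the members of this
family have `2p³ + 3p² + p + 3p·gcd(p-1,3) + (p+1)gcd(p-1,7) + gcd(p-1,8)`
descendants of order `p^8` (of maximal class 7). -/
theorem descendants_of_7_650 (p : ℕ) (hp : p.Prime) (h5 : 5 ≤ p) :
    Nat.card (Quot (fun s t :
        {s : LieRing (Fin (p ^ 8)) //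
          ∃ x : ℕ, x < p ∧
            IsMaxClassDescendantOf p (presLie p {bab - ba3, ba3b - x • ba5}) s} =>
      @IsLieIso _ _ s.1 t.1)) =
    2 * p ^ 3 + 3 * p ^ 2 + p + 3 * p * Nat.gcd (p - 1) 3 +
      (p + 1) * Nat.gcd (p - 1) 7 + Nat.gcd (p - 1) 8 := by
  have := Fact.mk hp
  exact (MaxClass.card_isFamDescendant h5).trans (MaxClass.NormalForm.card_orbits h5)
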